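/- arXiv:math-ph/0308005 — 6 statements merged into one kernel-verified Lean document; each statement's English description precedes it below -/
import Mathlib

section
/- Consider a Neumann star graph with b = αv bonds (α, v positive integers) whose lengths satisfy L_i ≥ L_min > 0 for all i. Then for every n, |⟨ψ^{(n)}|B|ψ^{(n)}⟩ − (∑_{i=1}^v L_i·sec²(k_n L_i))/(∑_{j=1}^{αv} L_j·sec²(k_n L_j))| ≤ 1/(L_min·k_n). In particular ⟨ψ^{(n)}|B|ψ^{(n)}⟩ equals the quoted quotient up to an error O(1/k_n) uniformly in v and in all length vectors with L_i ≥ L_min. -/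
open scoped Real

/-- `sec² x = (cos x)⁻²`. -/
noncomputable def sec2 (x : ℝ) : ℝ := (Real.cos x)⁻¹ ^ 2

/-- `k : ℕ → ℝ` enumerates, in increasing order, all the eigenvalues of the Neumann
star graph with bond lengths `L`, i.e. all positive solutions `k` (with
`cos (k L_j) ≠ 0` for all `j`) of `∑_j tan (k L_j) = 0`. -/
def IsEigenvalueSeq (b : ℕ) (L : Fin b → ℝ) (k : ℕ → ℝ) : Prop :=
  StrictMono k ∧ (∀ n, 0 < k n) ∧
  (∀ n j, Real.cos (k n * L j) ≠ 0) ∧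
  (∀ n, ∑ j, Real.tan (k n * L j) = 0) ∧
  (∀ x : ℝ, 0 < x → (∀ j, Real.cos (x * L j) ≠ 0) →
    ∑ j, Real.tan (x * L j) = 0 → ∃ n, k n = x)

theorem sec2_pos {x : ℝ} (hx : Real.cos x ≠ 0) : 0 < sec2 x := by
  unfold sec2; positivity

theorem abs_tan_le_sec2 {x : ℝ} (hx : Real.cos x ≠ 0) : |Real.tan x| ≤ sec2 x := by
  have h : sec2 x = 1 + |Real.tan x| ^ 2 := by
    rw [sq_abs, sec2, inv_pow, ← Real.inv_one_add_tan_sq hx, inv_inv]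
  nlinarith [sq_nonneg (|Real.tan x| - 1), abs_nonneg (Real.tan x)]

theorem integral_sq_cos_mul_sub {k : ℝ} (hk : k ≠ 0) (l : ℝ) :
    ∫ x in (0 : ℝ)..l, Real.cos (k * (x - l)) ^ 2 =
      l / 2 + Real.sin (k * l) * Real.cos (k * l) / (2 * k) := by
  have h := intervalIntegral.integral_comp_mul_sub (fun y => Real.cos y ^ 2) hk (k * l)
    (a := 0) (b := l)
  simp only [mul_sub]
  rw [h, integral_cos_sq]
  simp
  field_simp
  ring

theorem integral_sq_bond_eigenfunction {k l S : ℝ} (hk : k ≠ 0) (hS : 0 < S)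
    (hc : Real.cos (k * l) ≠ 0) :
    ∫ x in (0 : ℝ)..l, (Real.sqrt (2 * sec2 (k * l) / S) * Real.cos (k * (x - l))) ^ 2 =
      l * sec2 (k * l) / S + Real.tan (k * l) / (k * S) := by
  have hA : 0 ≤ 2 * sec2 (k * l) / S := by
    have := sec2_pos hc
    positivity
  simp only [mul_pow, Real.sq_sqrt hA]
  rw [intervalIntegral.integral_const_mul, integral_sq_cos_mul_sub hk, Real.tan_eq_sin_div_cos,
    sec2]
  field_simp

/-- For a star graph with `a * v` bonds of lengths `L i ≥ Lmin > 0`, the matrix element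
`⟨ψⁿ|B|ψⁿ⟩ = ∑_{i<v} ∫_0^{L_i} |ψ_iⁿ(x)|² dx` of the indicator observable of the first
`v` bonds equals `(∑_{i<v} L_i sec²(k_n L_i)) / (∑_j L_j sec²(k_n L_j))` up to an error
of at most `1/(Lmin · k_n)`. -/
theorem star_graph_matrix_element_estimate
    (a v : ℕ) (ha : 0 < a) (hv : 0 < v) (L : Fin (a * v) → ℝ)
    (Lmin : ℝ) (hLmin : 0 < Lmin) (hL : ∀ i, Lmin ≤ L i)
    (k : ℕ → ℝ) (hk : IsEigenvalueSeq (a * v) L k) (n : ℕ) :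
    |(∑ i, if i.val < v then
        ∫ x in (0:ℝ)..(L i),
          (Real.sqrt (2 * sec2 (k n * L i) / ∑ j, L j * sec2 (k n * L j)) *
            Real.cos (k n * (x - L i))) ^ 2
      else 0)
      - (∑ i, if i.val < v then L i * sec2 (k n * L i) else 0) /
          (∑ j, L j * sec2 (k n * L j))|
      ≤ 1 / (Lmin * k n) := by
  obtain ⟨-, hpos, hcos, -, -⟩ := hk
  have hk0 := hpos n
  have hb : 0 < a * v := Nat.mul_pos ha hv
  have hsec : ∀ i, 0 < sec2 (k n * L i) := fun i => sec2_pos (hcos n i)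
  set S := ∑ j, L j * sec2 (k n * L j)
  have hS : 0 < S :=
    Finset.sum_pos (fun i _ => mul_pos (hLmin.trans_le (hL i)) (hsec i)) ⟨⟨0, hb⟩, Finset.mem_univ _⟩
  simp only [integral_sq_bond_eigenfunction hk0.ne' hS (hcos n _)]
  rw [← Finset.sum_filter, ← Finset.sum_filter, Finset.sum_add_distrib, Finset.sum_div,
    add_sub_cancel_left, ← Finset.sum_div, abs_div, abs_of_pos (mul_pos hk0 hS),
    div_le_div_iff₀ (mul_pos hk0 hS) (mul_pos hLmin hk0)]
  have htan : Lmin * |∑ i with i.val < v, Real.tan (k n * L i)| ≤ S := calc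
    _ ≤ Lmin * ∑ i with i.val < v, |Real.tan (k n * L i)| := by
      gcongr
      exact Finset.abs_sum_le_sum_abs _ _
    _ ≤ Lmin * ∑ i, |Real.tan (k n * L i)| := by
      refine mul_le_mul_of_nonneg_left ?_ hLmin.le
      exact Finset.sum_le_sum_of_subset_of_nonneg (Finset.filter_subset _ _)
        fun _ _ _ => abs_nonneg _
    _ ≤ S := by
      rw [Finset.mul_sum]
      refine Finset.sum_le_sum fun i _ => ?_
      exact mul_le_mul (hL i) (abs_tan_le_sec2 (hcos n i)) (abs_nonneg _)
        (hLmin.le.trans (hL i))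
  linarith [mul_le_mul_of_nonneg_left htan hk0.le]
end

section
/- Let a, b ∈ ℂ with Re(a) ≥ 0, a ≠ 0, and Re(b) > 0. Then ∫_0^∞ exp(−ax − b√x) dx = 1/a − (√π/2)·(b/a^{3/2})·w(i·b/(2·a^{1/2})), where a^{1/2} and a^{3/2} are taken with the principal branch. -/
open scoped Real

/-- The error function `erf z = (2/√π) ∫_0^z e^{-t²} dt`, along the straight
segment from `0` to `z`. -/
noncomputable def cerf (z : ℂ) : ℂ :=
  2 / Real.sqrt Real.pi * (z * ∫ t in (0:ℝ)..1, Complex.exp (-(t * z) ^ 2))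

/-- `w(z) = e^{-z²} erfc(-iz)`. -/
noncomputable def wfun (z : ℂ) : ℂ :=
  Complex.exp (-z ^ 2) * (1 - cerf (-Complex.I * z))

open MeasureTheory Set Filter Topology

lemma norm_cexp_neg_sq_sub_le {a b : ℂ} (ha : 0 < a.re) {K : ℝ} (hK : ‖b‖ ≤ K) {t : ℝ}
    (ht : 0 ≤ t) :
    ‖Complex.exp (-a * t ^ 2 - b * t)‖ ≤
      Real.exp (K ^ 2 / (2 * a.re)) * Real.exp (-(a.re / 2) * t ^ 2) := by
  have hre : (-a * (t : ℂ) ^ 2 - b * t).re = -a.re * t ^ 2 - b.re * t := by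
    simp [pow_two]
  rw [Complex.norm_exp, ← Real.exp_add, Real.exp_le_exp, hre]
  have h1 : -b.re * t ≤ K * t :=
    mul_le_mul_of_nonneg_right
      (((neg_le_abs _).trans (Complex.abs_re_le_norm b)).trans hK) ht
  have h2 : K * t ≤ K ^ 2 / (2 * a.re) + a.re / 2 * t ^ 2 := by
    have h3 : K ^ 2 / (2 * a.re) + a.re / 2 * t ^ 2 - K * t
        = (K - a.re * t) ^ 2 / (2 * a.re) := by
      field_simp
      ring
    have h4 : 0 ≤ (K - a.re * t) ^ 2 / (2 * a.re) := by positivity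
    linarith
  linarith

lemma integrableOn_cexp_neg_sq_sub {a : ℂ} (ha : 0 < a.re) (b : ℂ) :
    IntegrableOn (fun t : ℝ => Complex.exp (-a * t ^ 2 - b * t)) (Ioi 0) := by
  refine Integrable.mono' (((integrable_exp_neg_mul_sq (half_pos ha)).const_mul
    (Real.exp (‖b‖ ^ 2 / (2 * a.re)))).integrableOn) (by fun_prop) ?_
  filter_upwards [ae_restrict_mem measurableSet_Ioi] with t ht
  exact norm_cexp_neg_sq_sub_le ha le_rfl (le_of_lt ht)

lemma norm_mul_cexp_neg_sq_sub_le {a b : ℂ} (ha : 0 < a.re) {K : ℝ} (hK : ‖b‖ ≤ K) {t : ℝ}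
    (ht : 0 ≤ t) :
    ‖t * Complex.exp (-a * t ^ 2 - b * t)‖ ≤
      Real.exp (K ^ 2 / (2 * a.re)) * (t * Real.exp (-(a.re / 2) * t ^ 2)) := by
  rw [norm_mul, Complex.norm_of_nonneg ht, mul_left_comm]
  exact mul_le_mul_of_nonneg_left (norm_cexp_neg_sq_sub_le ha hK ht) ht

lemma integrableOn_mul_cexp_neg_sq_sub {a : ℂ} (ha : 0 < a.re) (b : ℂ) :
    IntegrableOn (fun t : ℝ => t * Complex.exp (-a * t ^ 2 - b * t)) (Ioi 0) := by
  refine Integrable.mono' (((integrable_mul_exp_neg_mul_sq (half_pos ha)).const_mul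
    (Real.exp (‖b‖ ^ 2 / (2 * a.re)))).integrableOn) (by fun_prop) ?_
  filter_upwards [ae_restrict_mem measurableSet_Ioi] with t ht
  exact norm_mul_cexp_neg_sq_sub_le ha le_rfl (le_of_lt ht)

lemma two_mul_integral_mul_cexp_neg_sq_sub {a : ℂ} (ha : 0 < a.re) (b : ℂ) :
    2 * a * ∫ t in Ioi (0 : ℝ), t * Complex.exp (-a * t ^ 2 - b * t) =
      1 - b * ∫ t in Ioi (0 : ℝ), Complex.exp (-a * t ^ 2 - b * t) := by
  have hderiv (t : ℝ) : HasDerivAt (fun t : ℝ => Complex.exp (-a * t ^ 2 - b * t))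
      ((-2 * a) * (t * Complex.exp (-a * t ^ 2 - b * t)) +
        (-b) * Complex.exp (-a * t ^ 2 - b * t)) t := by
    have h : HasDerivAt (fun z : ℂ => Complex.exp (-a * z ^ 2 - b * z))
        (Complex.exp (-a * t ^ 2 - b * t) * (-a * (2 * t) - b)) t := by
      have := (((hasDerivAt_pow 2 (t : ℂ)).const_mul (-a)).sub
        ((hasDerivAt_id (t : ℂ)).const_mul b)).cexp
      simpa using! this
    convert! h.comp_ofReal using 1
    ring
  have i1 := (integrableOn_mul_cexp_neg_sq_sub ha b).const_mul (-2 * a)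
  have i2 := (integrableOn_cexp_neg_sq_sub ha b).const_mul (-b)
  have hlim := tendsto_zero_of_hasDerivAt_of_integrableOn_Ioi (a := 0)
    (fun t _ => hderiv t) (i1.add i2) (integrableOn_cexp_neg_sq_sub ha b)
  have key := integral_Ioi_of_hasDerivAt_of_tendsto' (a := 0) (fun t _ => hderiv t)
    (i1.add i2) hlim
  rw [integral_add i1 i2, integral_const_mul, integral_const_mul] at key
  simp only [Complex.ofReal_zero, ne_eq, OfNat.ofNat_ne_zero, not_false_eq_true, zero_pow,
    mul_zero, sub_zero, Complex.exp_zero] at key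
  linear_combination -key

lemma hasDerivAt_integral_cexp_neg_sq_sub {a : ℂ} (ha : 0 < a.re) (b : ℂ) :
    HasDerivAt (fun b : ℂ => ∫ t in Ioi (0 : ℝ), Complex.exp (-a * t ^ 2 - b * t))
      (-∫ t in Ioi (0 : ℝ), t * Complex.exp (-a * t ^ 2 - b * t)) b := by
  rw [← integral_neg]
  refine (hasDerivAt_integral_of_dominated_loc_of_deriv_le
    (F := fun (b : ℂ) (t : ℝ) => Complex.exp (-a * t ^ 2 - b * t))
    (F' := fun (b : ℂ) (t : ℝ) => -(t * Complex.exp (-a * t ^ 2 - b * t)))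
    (bound := fun t => Real.exp ((‖b‖ + 1) ^ 2 / (2 * a.re)) *
      (t * Real.exp (-(a.re / 2) * t ^ 2)))
    (Metric.ball_mem_nhds b one_pos) (Eventually.of_forall fun _ => by fun_prop)
    (integrableOn_cexp_neg_sq_sub ha b) (by fun_prop) ?_
    ((integrable_mul_exp_neg_mul_sq (half_pos ha)).const_mul _).integrableOn ?_).2
  · filter_upwards [ae_restrict_mem measurableSet_Ioi] with t ht c hc
    rw [norm_neg]
    refine norm_mul_cexp_neg_sq_sub_le ha ?_ (le_of_lt ht)
    have := norm_le_norm_add_norm_sub' c b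
    have h2 : ‖c - b‖ < 1 := by simpa [dist_eq_norm] using hc
    linarith
  · refine Eventually.of_forall fun t c _ => ?_
    have := (((hasDerivAt_id c).mul_const (t : ℂ)).const_sub (-a * (t : ℂ) ^ 2)).cexp
    convert! this using 1
    simp [mul_comm]

lemma cexp_mul_integral_cexp_neg_sq_sub {a : ℂ} (ha : 0 < a.re) (b : ℂ) :
    Complex.exp (-b ^ 2 / (4 * a)) * ∫ t in Ioi (0 : ℝ), Complex.exp (-a * t ^ 2 - b * t) =
      (π / a) ^ (1 / 2 : ℂ) / 2 -
        b / (2 * a) * ∫ s in (0 : ℝ)..1, Complex.exp (-(s * b) ^ 2 / (4 * a)) := by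
  have ha0 : a ≠ 0 := by
    rintro rfl
    simp at ha
  set G : ℂ → ℂ := fun b => ∫ t in Ioi (0 : ℝ), Complex.exp (-a * t ^ 2 - b * t) with hG
  have hderiv (s : ℝ) : HasDerivAt
      (fun s : ℝ => Complex.exp (-(s * b) ^ 2 / (4 * a)) * G (s * b))
      (-(b / (2 * a)) * Complex.exp (-(s * b) ^ 2 / (4 * a))) s := by
    have hl : HasDerivAt (fun z : ℂ => z * b) b (s : ℂ) := by
      simpa using (hasDerivAt_id (s : ℂ)).mul_const b
    have hGs := (hasDerivAt_integral_cexp_neg_sq_sub ha (s * b)).comp (s : ℂ) hl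
    have hE := ((hl.fun_pow 2).fun_neg.div_const (4 * a)).cexp
    have h := (hE.mul hGs).comp_ofReal
    convert! h using 1
    have hp := two_mul_integral_mul_cexp_neg_sq_sub ha (s * b)
    set J := ∫ t in Ioi (0 : ℝ), t * Complex.exp (-a * t ^ 2 - (s * b) * t)
    set I := ∫ t in Ioi (0 : ℝ), Complex.exp (-a * t ^ 2 - (s * b) * t) with hI
    have hc : ((fun b : ℂ => ∫ t in Ioi (0 : ℝ), Complex.exp (-a * t ^ 2 - b * t)) ∘
        fun z : ℂ => z * b) (s : ℂ) = I := rfl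
    rw [hc]
    have hJ : J = (1 - s * b * I) / (2 * a) := by
      field_simp
      linear_combination hp
    rw [hJ]
    field_simp
    push_cast
    ring
  have hftc := intervalIntegral.integral_eq_sub_of_hasDerivAt (a := 0) (b := 1)
    (fun s _ => hderiv s) (Continuous.intervalIntegrable (by fun_prop) _ _)
  rw [intervalIntegral.integral_const_mul] at hftc
  have h0 : G 0 = (π / a) ^ (1 / 2 : ℂ) / 2 := by
    rw [← integral_gaussian_complex_Ioi ha, hG]
    simp
  simp only [Complex.ofReal_one, one_mul, Complex.ofReal_zero, zero_mul, h0] at hftc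
  simp only [ne_eq, OfNat.ofNat_ne_zero, not_false_eq_true, zero_pow, neg_zero, zero_div,
    Complex.exp_zero, one_mul] at hftc
  change _ * G b = _
  linear_combination -hftc

lemma integral_cexp_neg_mul_sub_sqrt (a b : ℂ) :
    ∫ x in Ioi (0 : ℝ), Complex.exp (-a * x - b * √x) =
      2 * ∫ t in Ioi (0 : ℝ), t * Complex.exp (-a * t ^ 2 - b * t) := by
  rw [← integral_comp_rpow_Ioi_of_pos (p := 2) two_pos, ← integral_const_mul]
  refine setIntegral_congr_fun measurableSet_Ioi fun t ht => ?_
  have ht' : (0 : ℝ) ≤ t := le_of_lt ht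
  simp only [Real.rpow_two, Real.sqrt_sq ht', Complex.real_smul]
  norm_num
  ring

lemma continuous_cerf : Continuous cerf := by
  unfold cerf
  have : Continuous fun z : ℂ => ∫ t in (0 : ℝ)..1, Complex.exp (-(t * z) ^ 2) :=
    intervalIntegral.continuous_parametric_intervalIntegral_of_continuous' (by fun_prop) _ _
  fun_prop

lemma continuous_wfun : Continuous wfun := by
  unfold wfun
  have := continuous_cerf
  fun_prop

lemma cpow_one_half_sq (a : ℂ) : (a ^ (1 / 2 : ℂ)) ^ 2 = a := by
  simp

lemma cpow_three_halves {a : ℂ} (ha : a ≠ 0) :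
    a ^ (3 / 2 : ℂ) = a * a ^ (1 / 2 : ℂ) := by
  rw [show (3 / 2 : ℂ) = 1 + 1 / 2 by norm_num, Complex.cpow_add _ _ ha, Complex.cpow_one]

lemma integral_cexp_neg_mul_sub_sqrt_of_re_pos {a : ℂ} (ha : 0 < a.re) (b : ℂ) :
    ∫ x in Ioi (0 : ℝ), Complex.exp (-a * x - b * √x) =
      1 / a - √π / 2 * (b / a ^ (3 / 2 : ℂ)) *
        wfun (Complex.I * b / (2 * a ^ (1 / 2 : ℂ))) := by
  have ha0 : a ≠ 0 := by
    rintro rfl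
    simp at ha
  have hsq := cpow_one_half_sq a
  have hpi : (π / a) ^ (1 / 2 : ℂ) = √π / a ^ (1 / 2 : ℂ) := by
    have harg : a.arg ≠ π := by
      intro h
      have := (Complex.arg_eq_pi_iff.1 h).1
      linarith
    rw [Complex.cpow_def_of_ne_zero (div_ne_zero (by exact_mod_cast Real.pi_ne_zero) ha0),
      div_eq_mul_inv (π : ℂ) a, Complex.log_ofReal_mul Real.pi_pos (inv_ne_zero ha0), add_mul,
      Complex.exp_add, ← Complex.cpow_def_of_ne_zero (inv_ne_zero ha0),
      Complex.inv_cpow _ _ harg, Complex.ofReal_log Real.pi_pos.le,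
      ← Complex.cpow_def_of_ne_zero (by exact_mod_cast Real.pi_ne_zero), Real.sqrt_eq_rpow,
      Complex.ofReal_cpow Real.pi_pos.le]
    norm_num [div_eq_mul_inv]
  have hmain := cexp_mul_integral_cexp_neg_sq_sub ha b
  have hparts := two_mul_integral_mul_cexp_neg_sq_sub ha b
  rw [integral_cexp_neg_mul_sub_sqrt, cpow_three_halves ha0]
  rw [hpi] at hmain
  have hr : a ^ (1 / 2 : ℂ) ≠ 0 := by simp [Complex.cpow_eq_zero_iff, ha0]
  generalize a ^ (1 / 2 : ℂ) = r at *
  subst hsq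
  have hs : (√π : ℂ) ≠ 0 := by
    exact_mod_cast (Real.sqrt_pos.2 Real.pi_pos).ne'
  have hI : -Complex.I * (Complex.I * b / (2 * r)) = b / (2 * r) := by
    linear_combination -(b / (2 * r)) * Complex.I_mul_I
  have hE1 : -(Complex.I * b / (2 * r)) ^ 2 = b ^ 2 / (4 * r ^ 2) := by
    rw [div_pow, mul_pow, Complex.I_sq]
    ring
  have hE2 (s : ℝ) : -(s * (b / (2 * r))) ^ 2 = -(s * b) ^ 2 / (4 * r ^ 2) := by
    field_simp
    ring
  unfold wfun cerf
  rw [hI, hE1]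
  simp only [hE2]
  have hexp : Complex.exp (b ^ 2 / (4 * r ^ 2)) * Complex.exp (-b ^ 2 / (4 * r ^ 2)) = 1 := by
    rw [← Complex.exp_add, neg_div, add_neg_cancel, Complex.exp_zero]
  generalize (∫ s in (0 : ℝ)..1, Complex.exp (-(s * b) ^ 2 / (4 * r ^ 2))) = S at *
  generalize (∫ t in Ioi (0 : ℝ), t * Complex.exp (-r ^ 2 * t ^ 2 - b * t)) = J at *
  generalize (∫ t in Ioi (0 : ℝ), Complex.exp (-r ^ 2 * t ^ 2 - b * t)) = G at *
  generalize Complex.exp (b ^ 2 / (4 * r ^ 2)) = E at *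
  generalize Complex.exp (-b ^ 2 / (4 * r ^ 2)) = E' at *
  have hGval : G = E * (√π / r / 2 - b / (2 * r ^ 2) * S) := by
    linear_combination E * hmain - G * hexp
  have hJ : 2 * J = (1 - b * G) / r ^ 2 := by
    field_simp
    linear_combination hparts
  rw [hJ, hGval]
  field_simp

lemma tendsto_integral_cexp_neg_mul_sub_sqrt {a b : ℂ} (ha : 0 ≤ a.re) (hb : 0 < b.re) :
    Tendsto (fun ε : ℝ => ∫ x in Ioi (0 : ℝ), Complex.exp (-(a + ε) * x - b * √x)) (𝓝[>] 0)
      (𝓝 (∫ x in Ioi (0 : ℝ), Complex.exp (-a * x - b * √x))) := by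
  refine tendsto_integral_filter_of_dominated_convergence
    (fun x => Real.exp (-b.re * √x)) (Eventually.of_forall fun _ => by fun_prop) ?_ ?_ ?_
  · filter_upwards [self_mem_nhdsWithin] with ε hε
    filter_upwards [ae_restrict_mem measurableSet_Ioi] with x hx
    have hre : (-(a + ε) * (x : ℂ) - b * (√x : ℝ)).re = -(a.re + ε) * x - b.re * √x := by
      simp
    rw [Complex.norm_exp, Real.exp_le_exp, hre]
    have : 0 ≤ (a.re + ε) * x := mul_nonneg (add_nonneg ha (le_of_lt hε)) (le_of_lt hx)
    linarith
  · have := integrableOn_rpow_mul_exp_neg_mul_rpow (s := 0) (p := 1 / 2) (by norm_num)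
      (by norm_num) hb
    simpa [Real.sqrt_eq_rpow, IntegrableOn] using this
  · refine Eventually.of_forall fun x => ?_
    have : Continuous fun ε : ℝ => Complex.exp (-(a + ε) * x - b * √x) := by fun_prop
    simpa using (this.tendsto 0).mono_left nhdsWithin_le_nhds

/-- For `Re a ≥ 0`, `a ≠ 0` and `Re b > 0`:
`∫_0^∞ exp(−ax − b√x) dx = 1/a − (√π/2)(b/a^{3/2}) w(i b/(2 a^{1/2}))`,
the powers of `a` taken with the principal branch. -/
theorem integral_exp_sqrt (a b : ℂ) (ha : 0 ≤ a.re) (ha0 : a ≠ 0) (hb : 0 < b.re) :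
    ∫ x in Set.Ioi (0:ℝ), Complex.exp (-a * x - b * Real.sqrt x)
      = 1 / a - Real.sqrt Real.pi / 2 * (b / a ^ (3 / 2 : ℂ)) *
          wfun (Complex.I * b / (2 * a ^ (1 / 2 : ℂ))) := by
  have hslit : a ∈ Complex.slitPlane := by
    refine Complex.mem_slitPlane_iff.2 (ha.lt_or_eq.imp_right fun h him => ha0 ?_)
    exact Complex.ext h.symm him
  refine tendsto_nhds_unique (tendsto_integral_cexp_neg_mul_sub_sqrt ha hb) ?_
  have hcont : ContinuousAt (fun z : ℂ => 1 / z - √π / 2 * (b / z ^ (3 / 2 : ℂ)) *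
      wfun (Complex.I * b / (2 * z ^ (1 / 2 : ℂ)))) a := by
    have h1 : ContinuousAt (fun z : ℂ => z ^ (3 / 2 : ℂ)) a :=
      continuousAt_id.cpow continuousAt_const hslit
    have h2 : ContinuousAt (fun z : ℂ => z ^ (1 / 2 : ℂ)) a :=
      continuousAt_id.cpow continuousAt_const hslit
    have h3 : a ^ (3 / 2 : ℂ) ≠ 0 := by simp [Complex.cpow_eq_zero_iff, ha0]
    have h4 : 2 * a ^ (1 / 2 : ℂ) ≠ 0 := by simp [Complex.cpow_eq_zero_iff, ha0]
    exact (continuousAt_const.div continuousAt_id ha0).sub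
      ((continuousAt_const.mul (continuousAt_const.div h1 h3)).mul
        (continuous_wfun.continuousAt.comp
          (continuousAt_const.div (continuousAt_const.mul h2) h4)))
  have hε : Tendsto (fun ε : ℝ => a + (ε : ℂ)) (𝓝[>] 0) (𝓝 a) := by
    have : Continuous fun ε : ℝ => a + (ε : ℂ) := by fun_prop
    simpa using (this.tendsto 0).mono_left nhdsWithin_le_nhds
  refine (hcont.tendsto.comp hε).congr' ?_
  filter_upwards [self_mem_nhdsWithin] with ε hε
  refine (integral_cexp_neg_mul_sub_sqrt_of_re_pos ?_ b).symm
  simpa using add_pos_of_nonneg_of_pos ha hε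
end

section
/- Let v ≥ 3, let L_1,…,L_v > 0 be linearly independent over ℚ, and let 1 < v* < v be an integer. For n ∈ ℕ and 1 ≤ i ≤ v set p_{n,i} := (π/L_i)(1/2 + n). Then for every ε > 0 there exist infinitely many n ∈ ℕ such that: (a) for each i = 2,…,v* there exists m ∈ ℕ with |p_{m,i} − p_{n,1}| ≤ ε/2; and (b) for all i = v*+1,…,v and all m ∈ ℕ, |p_{m,i} − p_{n,1}| ≥ π/(2L_i) − ε/2. -/
open scoped Real

/-- `p_{n,i} = (π/L_i)(1/2 + n)`, the `n`-th positive pole of `k ↦ tan (k L_i)`. -/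
noncomputable def pole {v : ℕ} (L : Fin v → ℝ) (i : Fin v) (n : ℕ) : ℝ :=
  Real.pi / L i * (1 / 2 + n)

open Filter MeasureTheory UnitAddTorus Topology

namespace UnitAddTorus

variable {d : Type*} [Fintype d]

theorem mFourier_add_apply (n : d → ℤ) (x y : UnitAddTorus d) :
    mFourier n (x + y) = mFourier n x * mFourier n y := by
  simp only [mFourier, ContinuousMap.coe_mk, fourier_apply, Pi.add_apply, smul_add,
    AddCircle.toCircle_add, Circle.coe_mul, Finset.prod_mul_distrib]

theorem mFourier_nsmul_apply (n : d → ℤ) (k : ℕ) (x : UnitAddTorus d) :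
    mFourier n (k • x) = mFourier n x ^ k := by
  induction k with
  | zero => simp [mFourier]
  | succ k ih => rw [succ_nsmul, mFourier_add_apply, ih, pow_succ]

theorem mFourier_coe_apply (n : d → ℤ) (x : d → ℝ) :
    mFourier n (fun i ↦ (x i : UnitAddCircle)) =
      Complex.exp (2 * Real.pi * Complex.I * ∑ i, (n i * x i : ℂ)) := by
  simp only [mFourier, ContinuousMap.coe_mk, fourier_coe_apply, Finset.mul_sum, Complex.exp_sum]
  refine Finset.prod_congr rfl fun i _ ↦ ?_
  congr 1
  push_cast
  ring

theorem norm_mFourier_apply (n : d → ℤ) (x : UnitAddTorus d) : ‖mFourier n x‖ = 1 := by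
  simp only [mFourier, fourier_apply, ContinuousMap.coe_mk, norm_prod, Circle.norm_coe,
    Finset.prod_const_one]

theorem measureReal_univ : (volume : Measure (UnitAddTorus d)).real Set.univ = 1 := by
  simp [Measure.real, volume_pi, Measure.pi_univ]

theorem integral_mFourier_eq_zero {n : d → ℤ} {a : UnitAddTorus d} (h : mFourier n a ≠ 1) :
    ∫ x, mFourier n x = 0 := by
  have key : ∫ x, mFourier n (x + a) = ∫ x, mFourier n x :=
    integral_add_right_eq_self (μ := (volume : Measure (UnitAddTorus d))) (mFourier n) a
  simp only [mFourier_add_apply, integral_mul_const] at key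
  by_contra h0
  exact h (mul_left_cancel₀ h0 (by rw [key, mul_one]))

theorem tendsto_average_mFourier {a : UnitAddTorus d} (ha : ∀ n ≠ 0, mFourier n a ≠ 1)
    (x : UnitAddTorus d) (n : d → ℤ) :
    Tendsto (fun M : ℕ ↦ (M : ℂ)⁻¹ * ∑ k ∈ Finset.range M, mFourier n (x + k • a)) atTop
      (𝓝 (∫ y, mFourier n y)) := by
  rcases eq_or_ne n 0 with rfl | hn
  · refine Tendsto.congr' (f₁ := fun _ ↦ 1) ?_ (by simp [mFourier_zero, measureReal_univ])
    filter_upwards [eventually_ne_atTop 0] with M hM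
    simp [mFourier_zero, hM]
  · have h1 := ha n hn
    rw [integral_mFourier_eq_zero h1]
    refine squeeze_zero_norm (a := fun M : ℕ ↦ (M : ℝ)⁻¹ * (2 / ‖mFourier n a - 1‖)) ?_ ?_
    · intro M
      simp only [mFourier_add_apply, mFourier_nsmul_apply, ← Finset.mul_sum, geom_sum_eq h1,
        norm_mul, norm_inv, norm_div, norm_mFourier_apply, one_mul, Complex.norm_natCast]
      gcongr
      refine (norm_sub_le _ _).trans ?_
      rw [norm_pow, norm_mFourier_apply]
      norm_num
    · simpa using (tendsto_inv_atTop_nhds_zero_nat (𝕜 := ℝ)).mul_const (2 / ‖mFourier n a - 1‖)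

theorem tendsto_average_of_mem_span {a : UnitAddTorus d} (ha : ∀ n ≠ 0, mFourier n a ≠ 1)
    (x : UnitAddTorus d) {p : C(UnitAddTorus d, ℂ)}
    (hp : p ∈ Submodule.span ℂ (Set.range (mFourier (d := d)))) :
    Tendsto (fun M : ℕ ↦ (M : ℂ)⁻¹ * ∑ k ∈ Finset.range M, p (x + k • a)) atTop
      (𝓝 (∫ y, p y)) := by
  have hint (f : C(UnitAddTorus d, ℂ)) : Integrable f :=
    f.continuous.integrable_of_hasCompactSupport (.of_compactSpace f)
  induction hp using Submodule.span_induction with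
  | mem f hf =>
    obtain ⟨n, rfl⟩ := hf
    exact tendsto_average_mFourier ha x n
  | zero => simp
  | add f g _ _ hf hg =>
    simp only [ContinuousMap.add_apply, Finset.sum_add_distrib, mul_add]
    rw [integral_add (hint f) (hint g)]
    exact hf.add hg
  | smul c f _ hf =>
    simp only [ContinuousMap.smul_apply, smul_eq_mul, ← Finset.mul_sum, integral_const_mul]
    simpa only [mul_left_comm] using hf.const_mul c

/-- **Kronecker's theorem**: if no nontrivial character is trivial at `a`, then every forward orbit
of the translation by `a` meets every ball. -/
theorem exists_dist_add_nsmul_lt {a : UnitAddTorus d} (ha : ∀ n ≠ 0, mFourier n a ≠ 1)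
    (x t : UnitAddTorus d) {r : ℝ} (hr : 0 < r) : ∃ k : ℕ, dist (x + k • a) t < r := by
  by_contra! hfar
  let g : UnitAddTorus d → ℝ := fun y ↦ max 0 (r - dist y t)
  have hg : Continuous g := by fun_prop
  have hpos : 0 < ∫ y, g y :=
    hg.integral_pos_of_hasCompactSupport_nonneg_nonzero (.of_compactSpace g)
      (fun y ↦ le_max_left _ _) (x := t) (by simp [g, hr.not_ge])
  let f : C(UnitAddTorus d, ℂ) := ⟨fun y ↦ (g y : ℂ), by fun_prop⟩
  have hf : ∫ y, f y = ((∫ y, g y : ℝ) : ℂ) := integral_ofReal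
  have hint (f : C(UnitAddTorus d, ℂ)) : Integrable f :=
    f.continuous.integrable_of_hasCompactSupport (.of_compactSpace f)
  obtain ⟨p, hp, hpf⟩ : ∃ p ∈ Submodule.span ℂ (Set.range (mFourier (d := d))),
      dist f p < (∫ y, g y) / 2 := by
    have : f ∈ (Submodule.span ℂ (Set.range (mFourier (d := d)))).topologicalClosure := by
      rw [span_mFourier_closure_eq_top]; trivial
    exact Metric.mem_closure_iff.1 this _ (half_pos hpos)
  have hnear (y) : ‖f y - p y‖ ≤ dist f p := by
    rw [← dist_eq_norm]; exact ContinuousMap.dist_apply_le_dist y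
  have hzero (k : ℕ) : f (x + k • a) = 0 := by
    simp [f, g, hfar k]
  have hlim : ‖∫ y, p y‖ ≤ dist f p := by
    refine le_of_tendsto (tendsto_average_of_mem_span ha x hp).norm ?_
    filter_upwards [eventually_ne_atTop 0] with M hM
    have hsum : ‖∑ k ∈ Finset.range M, p (x + k • a)‖ ≤ M * dist f p := by
      refine (norm_sum_le_of_le (n := fun _ ↦ dist f p) _ fun k _ ↦ ?_).trans_eq (by simp)
      simpa [hzero] using hnear (x + k • a)
    rw [norm_mul, norm_inv, Complex.norm_natCast, inv_mul_le_iff₀ (by positivity)]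
    exact hsum
  have hdiff : ‖(∫ y, f y) - ∫ y, p y‖ ≤ dist f p := by
    rw [← integral_sub (hint f) (hint p)]
    simpa [measureReal_univ] using norm_integral_le_of_norm_le_const
      (μ := (volume : Measure (UnitAddTorus d))) (ae_of_all _ hnear)
  have h := norm_sub_norm_le (∫ y, f y) (∫ y, p y)
  rw [hf, Complex.norm_real, Real.norm_of_nonneg hpos.le, ← hf] at h
  linarith

end UnitAddTorus

/-- Simultaneous inhomogeneous approximation modulo `1`. -/
theorem exists_nat_int_abs_lt {w : ℕ} {L : Fin (w + 1) → ℝ} (h0 : L 0 ≠ 0)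
    (hind : LinearIndependent ℚ L) (t : Fin w → ℝ) {δ : ℝ} (hδ : 0 < δ) (N : ℕ) :
    ∃ n, N ≤ n ∧ ∀ i : Fin w, ∃ k : ℤ, |n * (L i.succ / L 0) - t i - k| < δ := by
  let a : UnitAddTorus (Fin w) := fun i ↦ ((L i.succ / L 0 : ℝ) : UnitAddCircle)
  have ha : ∀ n ≠ 0, mFourier n a ≠ 1 := by
    intro n hn h
    rw [mFourier_coe_apply, Complex.exp_eq_one_iff] at h
    obtain ⟨k, hk⟩ := h
    have hk' : ∑ i, (n i * ((L i.succ / L 0 : ℝ) : ℂ)) = k :=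
      mul_left_cancel₀ Complex.two_pi_I_ne_zero (by rw [hk]; ring)
    have hk'' : ∑ i, (n i * (L i.succ / L 0)) = (k : ℝ) := by exact_mod_cast hk'
    have hrel : ∑ i, (Fin.cons (-k : ℚ) (fun i ↦ (n i : ℚ)) : Fin (w + 1) → ℚ) i • L i = 0 := by
      rw [Fin.sum_univ_succ]
      simp only [Fin.cons_zero, Fin.cons_succ, Rat.smul_def]
      push_cast
      rw [← hk'', neg_mul, Finset.sum_mul, neg_add_eq_zero]
      refine Finset.sum_congr rfl fun i _ ↦ ?_
      field_simp
    have hcoef := Fintype.linearIndependent_iff.1 hind _ hrel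
    refine hn (funext fun i ↦ ?_)
    simpa using hcoef i.succ
  obtain ⟨k, hk⟩ := exists_dist_add_nsmul_lt ha (N • a) (fun i ↦ (t i : UnitAddCircle)) hδ
  refine ⟨N + k, by omega, fun i ↦ ?_⟩
  have hi := (dist_pi_lt_iff hδ).1 hk i
  rw [← add_nsmul, Pi.smul_apply, dist_eq_norm, ← AddCircle.coe_nsmul, ← AddCircle.coe_sub,
    UnitAddCircle.norm_eq, nsmul_eq_mul] at hi
  exact ⟨_, hi⟩

theorem pole_sub_pole {v : ℕ} (L : Fin v → ℝ) {i j : Fin v} (hi : L i ≠ 0) (m n : ℕ) :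
    pole L i m - pole L j n = Real.pi / L i * (1 / 2 + m - L i / L j * (1 / 2 + n)) := by
  unfold pole
  field_simp

/-- For rationally independent bond lengths there are infinitely many `n` such that
the poles of `tan (k L_i)` for the bonds `i = 2, …, v*` come within `ε/2` of
`p_{n,1}`, while for `i = v*+1, …, v` all poles stay at distance at least
`π/(2 L_i) − ε/2` from `p_{n,1}`.  (Bond `1` is the index `0` of `Fin v`; a
1-based bond label `i` corresponds to the index `i - 1`.) -/
theorem pole_clustering (v : ℕ) (hv : 3 ≤ v) (L : Fin v → ℝ) (hL : ∀ i, 0 < L i)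
    (hind : LinearIndependent ℚ L) (vs : ℕ) (h1 : 1 < vs) (h2 : vs < v)
    (ε : ℝ) (hε : 0 < ε) :
    ∀ N : ℕ, ∃ n : ℕ, N ≤ n ∧
      (∀ i : Fin v, 1 ≤ i.val → i.val < vs →
        ∃ m : ℕ, |pole L i m - pole L ⟨0, by omega⟩ n| ≤ ε / 2) ∧
      (∀ i : Fin v, vs ≤ i.val → ∀ m : ℕ,
        Real.pi / (2 * L i) - ε / 2 ≤ |pole L i m - pole L ⟨0, by omega⟩ n|) := by
  obtain ⟨w, rfl⟩ : ∃ w, v = w + 1 := ⟨v - 1, by omega⟩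
  intro N
  have hzero : (⟨0, by omega⟩ : Fin (w + 1)) = 0 := rfl
  simp only [hzero]
  obtain ⟨δ, hδ, hδ2, hδL⟩ : ∃ δ : ℝ, 0 < δ ∧ δ < 1 / 2 ∧ ∀ i, Real.pi / L i * δ ≤ ε / 2 := by
    have hlim (i) : ∀ᶠ δ in 𝓝[>] (0 : ℝ), Real.pi / L i * δ < ε / 2 := by
      refine nhdsWithin_le_nhds (ContinuousAt.eventually_lt (by fun_prop) (by fun_prop) ?_)
      simpa using hε
    obtain ⟨δ, h, hδ⟩ := ((eventually_all.2 hlim).and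
      (Ioo_mem_nhdsGT (show (0 : ℝ) < 1 / 2 by norm_num))).exists
    exact ⟨δ, hδ.1, hδ.2, fun i ↦ (h i).le⟩
  obtain ⟨n, hn, happrox⟩ := exists_nat_int_abs_lt (hL 0).ne' hind
    (fun i ↦ (if i.succ.val < vs then 1 / 2 else 0) - L i.succ / L 0 / 2) hδ N
  refine ⟨n, hn, fun i hi1 hi2 ↦ ?_, fun i hi m ↦ ?_⟩
  · obtain ⟨j, rfl⟩ := Fin.exists_succ_eq.2 (show i ≠ 0 by rintro rfl; simp at hi1)
    obtain ⟨k, hk⟩ := happrox j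
    rw [if_pos hi2] at hk
    have hq : 0 < L j.succ / L 0 := div_pos (hL _) (hL _)
    have hk0 : 0 ≤ k := by
      have hqn : 0 ≤ n * (L j.succ / L 0) := by positivity
      have : (-1 : ℝ) < k := by linarith [(abs_lt.1 hk).2]
      have : -1 < k := by exact_mod_cast this
      omega
    lift k to ℕ using hk0
    refine ⟨k, ?_⟩
    rw [pole_sub_pole L (hL _).ne', abs_mul, abs_of_pos (div_pos Real.pi_pos (hL _))]
    refine le_trans ?_ (hδL j.succ)
    have := div_pos Real.pi_pos (hL j.succ)
    gcongr
    rw [abs_sub_comm]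
    rw [Int.cast_natCast] at hk
    exact (congrArg abs (by ring)).trans_le hk.le
  · obtain ⟨j, rfl⟩ := Fin.exists_succ_eq.2 (show i ≠ 0 by rintro rfl; simp at hi; omega)
    obtain ⟨k, hk⟩ := happrox j
    rw [if_neg hi.not_gt] at hk
    have hpos := div_pos Real.pi_pos (hL j.succ)
    rw [pole_sub_pole L (hL _).ne', abs_mul, abs_of_pos hpos]
    have hhalf : (1 / 2 : ℝ) ≤ |1 / 2 + (m : ℝ) - (k : ℝ)| := by
      rcases le_or_gt k m with h | h
      · have : (k : ℝ) ≤ m := by exact_mod_cast h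
        exact le_abs.2 (.inl (by linarith))
      · have : (m : ℝ) + 1 ≤ k := by exact_mod_cast h
        exact le_abs.2 (.inr (by linarith))
    have hdist : 1 / 2 - δ ≤ |1 / 2 + m - L j.succ / L 0 * (1 / 2 + n)| := by
      have htri := abs_add_le (1 / 2 + m - L j.succ / L 0 * (1 / 2 + n))
        (n * (L j.succ / L 0) - (0 - L j.succ / L 0 / 2) - k)
      rw [show 1 / 2 + (m : ℝ) - L j.succ / L 0 * (1 / 2 + n) +
        (n * (L j.succ / L 0) - (0 - L j.succ / L 0 / 2) - k) = 1 / 2 + m - k by ring] at htri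
      linarith
    calc Real.pi / (2 * L j.succ) - ε / 2
        ≤ Real.pi / (2 * L j.succ) - Real.pi / L j.succ * δ := by linarith [hδL j.succ]
      _ = Real.pi / L j.succ * (1 / 2 - δ) := by field_simp
      _ ≤ _ := by gcongr
end

section
/- Let v ≥ 3, let L_1,…,L_v > 0 be linearly independent over ℚ, and let 1 < v* < v be an integer. Then there exists a strictly increasing sequence (κ_r) of positive real numbers with κ_r → ∞, each satisfying cos(κ_r·L_j) ≠ 0 for all j and ∑_{j=1}^v tan(κ_r·L_j) = 0, such that sec²(κ_r·L_i) → ∞ as r → ∞ for each i = 1,…,v*, and sec²(κ_r·L_i) → 1 as r → ∞ for each i = v*+1,…,v. -/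
open scoped Real Topology
open Filter

open MeasureTheory in
/-- The Haar integral of a nontrivial exponential monomial on the torus vanishes. -/
lemma integral_mFourier_eq_zero {ι : Type*} [Fintype ι] {n : ι → ℤ} (hn : n ≠ 0) :
    ∫ x, UnitAddTorus.mFourier n x ∂(Measure.pi fun _ : ι => AddCircle.haarAddCircle (T := 1)) =
      0 := by
  obtain ⟨i, hi⟩ := Function.ne_iff.mp hn
  have h := integral_fintype_prod_eq_prod
    (μ := fun _ : ι => AddCircle.haarAddCircle (T := 1)) (𝕜 := ℂ)
    (fun i (x : UnitAddCircle) => (fourier (n i) x : ℂ))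
  refine Eq.trans h (Finset.prod_eq_zero (Finset.mem_univ i) ?_)
  exact integral_eq_zero_of_add_right_eq_neg (fourier_add_half_inv_index hi one_pos)

/-- The mean of `exp (i β t)` over `[T, T + N]` tends to zero if `β ≠ 0`. -/
lemma tendsto_mean_exp {β : ℝ} (hβ : β ≠ 0) (T : ℝ) :
    Tendsto (fun N : ℕ => (N : ℂ)⁻¹ * ∫ t in T..T + N, Complex.exp (β * Complex.I * t)) atTop
      (𝓝 0) := by
  have hc : (β : ℂ) * Complex.I ≠ 0 := by simp [hβ]
  simp_rw [integral_exp_mul_complex hc]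
  refine squeeze_zero_norm (a := fun N : ℕ => (N : ℝ)⁻¹ * (2 / |β|)) (fun N => ?_) ?_
  · rw [norm_mul, norm_inv, Complex.norm_natCast, norm_div]
    have h (x : ℝ) : ‖Complex.exp (β * Complex.I * x)‖ = 1 := by
      have : (β : ℂ) * Complex.I * x = (β * x : ℝ) * Complex.I := by push_cast; ring
      rw [this, Complex.norm_exp_ofReal_mul_I]
    have h2 : ‖(β : ℂ) * Complex.I‖ = |β| := by simp
    rw [h2]
    gcongr
    calc _ ≤ _ := norm_sub_le _ _
      _ = 2 := by rw [h, h]; norm_num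
  · simpa using tendsto_inv_atTop_nhds_zero_nat.mul_const (2 / |β|)

/-- The linear flow `t ↦ t • a` on the torus. -/
def torusFlow {ι : Type*} (a : ι → ℝ) (t : ℝ) : UnitAddTorus ι :=
  fun i => ((t * a i : ℝ) : UnitAddCircle)

lemma continuous_torusFlow {ι : Type*} (a : ι → ℝ) : Continuous (torusFlow a) :=
  continuous_pi fun i => (AddCircle.continuous_mk' 1).comp (continuous_id.mul_const (a i))

lemma mFourier_torusFlow {ι : Type*} [Fintype ι] (a : ι → ℝ) (n : ι → ℤ) (t : ℝ) :
    UnitAddTorus.mFourier n (torusFlow a t) =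
      Complex.exp ((2 * π * ∑ i, n i * a i : ℝ) * Complex.I * t) := by
  simp only [UnitAddTorus.mFourier, torusFlow, ContinuousMap.coe_mk, fourier_coe_apply]
  rw [← Complex.exp_sum]
  congr 1
  push_cast
  rw [Finset.mul_sum, Finset.sum_mul, Finset.sum_mul]
  exact Finset.sum_congr rfl fun i _ => by ring

open MeasureTheory in
/-- Time averages of trigonometric polynomials along an irrational flow converge to the space
average. -/
lemma tendsto_mean_torusFlow {ι : Type*} [Fintype ι] {a : ι → ℝ} (ha : LinearIndependent ℚ a)
    (T : ℝ) {p : C(UnitAddTorus ι, ℂ)}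
    (hp : p ∈ Submodule.span ℂ (Set.range (UnitAddTorus.mFourier (d := ι)))) :
    Tendsto (fun N : ℕ => (N : ℂ)⁻¹ * ∫ t in T..T + N, p (torusFlow a t)) atTop
      (𝓝 (∫ x, p x ∂(Measure.pi fun _ : ι => AddCircle.haarAddCircle (T := 1)))) := by
  have hqi (q : C(UnitAddTorus ι, ℂ)) (c d : ℝ) :
      IntervalIntegrable (fun t => q (torusFlow a t)) volume c d :=
    (q.continuous.comp (continuous_torusFlow a)).intervalIntegrable _ _
  have hqi' (q : C(UnitAddTorus ι, ℂ)) :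
      Integrable q (Measure.pi fun _ : ι => AddCircle.haarAddCircle (T := 1)) :=
    q.continuous.integrable_of_hasCompactSupport (HasCompactSupport.of_compactSpace _)
  induction hp using Submodule.span_induction with
  | mem x hx =>
    obtain ⟨n, rfl⟩ := hx
    rcases eq_or_ne n 0 with rfl | hn
    · simp only [UnitAddTorus.mFourier_zero, ContinuousMap.one_apply, integral_const,
        intervalIntegral.integral_const, probReal_univ, one_smul, add_sub_cancel_left]
      refine tendsto_const_nhds.congr' ?_
      filter_upwards [eventually_ne_atTop 0] with N hN
      simp [hN]
    · rw [integral_mFourier_eq_zero hn]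
      simp_rw [mFourier_torusFlow]
      refine tendsto_mean_exp (mul_ne_zero (by positivity) fun h0 => hn ?_) T
      have h := Fintype.linearIndependent_iff.mp ha (fun i => (n i : ℚ)) (by
        rw [← h0]
        exact Finset.sum_congr rfl fun i _ => by simp [Rat.smul_def])
      exact funext fun i => by exact_mod_cast h i
  | zero => simp
  | add x y _ _ hx hy =>
    simp only [ContinuousMap.add_apply]
    rw [integral_add (hqi' x) (hqi' y)]
    refine (hx.add hy).congr fun N => ?_
    rw [intervalIntegral.integral_add (hqi x _ _) (hqi y _ _), mul_add]
  | smul c x _ hx =>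
    simp only [ContinuousMap.smul_apply]
    rw [integral_smul]
    refine (hx.const_smul c).congr fun N => ?_
    rw [intervalIntegral.integral_smul, smul_eq_mul, smul_eq_mul]
    ring

open MeasureTheory in
/-- Every forward half-orbit of an irrational flow on the torus meets every nonempty open set. -/
lemma exists_torusFlow_mem {ι : Type*} [Fintype ι] {a : ι → ℝ} (ha : LinearIndependent ℚ a)
    (T : ℝ) {U : Set (UnitAddTorus ι)} (hU : IsOpen U) (hne : U.Nonempty) :
    ∃ t, T < t ∧ torusFlow a t ∈ U := by
  obtain ⟨x₀, hx₀⟩ := hne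
  by_contra! hcon
  set μ : Measure (UnitAddTorus ι) := Measure.pi fun _ : ι => AddCircle.haarAddCircle (T := 1)
  obtain ⟨g, hg0, hg1, hg⟩ := exists_continuous_zero_one_of_isClosed hU.isClosed_compl
    (isClosed_singleton (x := x₀)) (by simpa using hx₀)
  have hpos : 0 < ∫ x, g x ∂μ :=
    g.continuous.integral_pos_of_hasCompactSupport_nonneg_nonzero (x := x₀)
      (HasCompactSupport.of_compactSpace _) (fun x => (hg x).1) (by simp [hg1 rfl])
  set I := ∫ x, g x ∂μ
  let f : C(UnitAddTorus ι, ℂ) := ⟨fun x => (g x : ℂ), by fun_prop⟩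
  have hfI : ∫ x, f x ∂μ = I := integral_ofReal
  have hf0 (t : ℝ) (ht : T < t) : f (torusFlow a t) = 0 := by
    simpa [f] using hg0 (hcon t ht)
  have hmem : f ∈ closure
      (Submodule.span ℂ (Set.range (UnitAddTorus.mFourier (d := ι))) : Set C(UnitAddTorus ι, ℂ)) := by
    rw [← Submodule.topologicalClosure_coe, UnitAddTorus.span_mFourier_closure_eq_top]
    trivial
  obtain ⟨p, hp, hdist⟩ := Metric.mem_closure_iff.mp hmem (I / 3) (by positivity)
  have hfp (x : UnitAddTorus ι) : ‖f x - p x‖ ≤ I / 3 := by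
    rw [← dist_eq_norm]
    exact (ContinuousMap.dist_apply_le_dist x).trans hdist.le
  have hqi (q : C(UnitAddTorus ι, ℂ)) : Integrable q μ :=
    q.continuous.integrable_of_hasCompactSupport (HasCompactSupport.of_compactSpace _)
  have hspace : ‖(I : ℂ) - ∫ x, p x ∂μ‖ ≤ I / 3 := by
    rw [← hfI, ← integral_sub (hqi f) (hqi p)]
    simpa using norm_integral_le_of_norm_le_const (μ := μ) (Eventually.of_forall hfp)
  have htime : ‖∫ x, p x ∂μ‖ ≤ I / 3 := by
    refine le_of_tendsto (tendsto_mean_torusFlow ha T hp).norm ?_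
    filter_upwards [eventually_gt_atTop 0] with N hN
    have hN' : (0 : ℝ) < N := by exact_mod_cast hN
    have h : ‖∫ t in T..T + N, p (torusFlow a t)‖ ≤ I / 3 * |T + N - T| := by
      refine intervalIntegral.norm_integral_le_of_norm_le_const fun t ht => ?_
      rw [Set.uIoc_of_le (by linarith)] at ht
      simpa [hf0 t ht.1] using hfp (torusFlow a t)
    rw [add_sub_cancel_left, abs_of_pos hN'] at h
    rw [norm_mul, norm_inv, Complex.norm_natCast, inv_mul_le_iff₀ hN']
    linarith
  have hI : ‖(I : ℂ)‖ = I := by simp [abs_of_pos hpos]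
  have := norm_add_le ((I : ℂ) - ∫ x, p x ∂μ) (∫ x, p x ∂μ)
  rw [sub_add_cancel, hI] at this
  linarith

/-- **Kronecker's approximation theorem**, continuous version, with arbitrarily large times. -/
lemma exists_abs_mul_sub_int_lt {ι : Type*} [Fintype ι] {a : ι → ℝ}
    (ha : LinearIndependent ℚ a) (θ : ι → ℝ) {δ : ℝ} (hδ : 0 < δ) (T : ℝ) :
    ∃ t, T < t ∧ ∃ n : ι → ℤ, ∀ i, |t * a i - θ i - n i| < δ := by
  obtain ⟨t, ht, hmem⟩ := exists_torusFlow_mem ha T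
    (Metric.isOpen_ball (x := fun i => ((θ i : ℝ) : UnitAddCircle)) (ε := δ))
    ⟨_, Metric.mem_ball_self hδ⟩
  refine ⟨t, ht, fun i => round (t * a i - θ i), fun i => ?_⟩
  have h := (dist_pi_lt_iff hδ).mp hmem i
  rwa [torusFlow, dist_eq_norm, ← AddCircle.coe_sub, UnitAddCircle.norm_eq] at h

/-- If `∑ c = 0`, then the star graph with rationally independent bond lengths has arbitrarily
large eigenvalues `k` with `tan (k L_i)` close to `c_i` for all `i`. -/
lemma exists_eigenvalue_tan_near {ι : Type*} [Fintype ι] [Nonempty ι] {L : ι → ℝ}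
    (hL : ∀ i, 0 < L i) (hind : LinearIndependent ℚ L) (c : ι → ℝ) (hc : ∑ i, c i = 0)
    {ε : ℝ} (hε : 0 < ε) (T : ℝ) :
    ∃ k, T < k ∧ (∀ i, Real.cos (k * L i) ≠ 0) ∧ ∑ i, Real.tan (k * L i) = 0 ∧
      ∀ i, |Real.tan (k * L i) - c i| < ε := by
  let θ i := Real.arctan (c i)
  have hθ i : θ i ∈ Set.Ioo (-(π / 2)) (π / 2) := Real.arctan_mem_Ioo _
  have hnear : ∀ i, ∀ᶠ s in 𝓝[>] (0 : ℝ), ∀ x, |x - θ i| < 2 * s * L i →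
      x ∈ Set.Ioo (-(π / 2)) (π / 2) ∧ |Real.tan x - c i| < ε := by
    intro i
    have h1 : ∀ᶠ x in 𝓝 (θ i), x ∈ Set.Ioo (-(π / 2)) (π / 2) ∧ |Real.tan x - c i| < ε := by
      refine Filter.Eventually.and (isOpen_Ioo.mem_nhds (hθ i)) ?_
      have h := (Real.continuousAt_tan.mpr (Real.cos_pos_of_mem_Ioo (hθ i)).ne').eventually
        (Metric.ball_mem_nhds _ hε)
      simpa [θ, Real.tan_arctan, Real.dist_eq] using h
    obtain ⟨δ, hδ, h⟩ := Metric.eventually_nhds_iff.mp h1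
    have hs : ∀ᶠ s in 𝓝 (0 : ℝ), 2 * s * L i < δ :=
      ContinuousAt.eventually_lt (by fun_prop) continuousAt_const (by simpa using hδ)
    filter_upwards [nhdsWithin_le_nhds hs] with s hs x hx
    exact h (by rw [Real.dist_eq]; linarith)
  obtain ⟨η, hη, hη0⟩ := ((eventually_all.mpr hnear).and self_mem_nhdsWithin).exists
  obtain ⟨i₀, hi₀⟩ := Finite.exists_min L
  have hδ : 0 < η * L i₀ / π := by have := hL i₀; positivity
  obtain ⟨t, ht, n, hn⟩ :=
    exists_abs_mul_sub_int_lt hind (fun i => θ i / π) hδ ((T + η) / π)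
  let k₀ := t * π
  have hk₀ : T + η < k₀ := (div_lt_iff₀ Real.pi_pos).mp ht
  have hclose i : |k₀ * L i - n i * π - θ i| < η * L i := by
    have h1 : k₀ * L i - n i * π - θ i = (t * L i - θ i / π - n i) * π := by
      have := Real.pi_ne_zero
      simp only [k₀]; field_simp; ring
    rw [h1, abs_mul, abs_of_pos Real.pi_pos]
    calc _ < η * L i₀ / π * π := by gcongr; exact hn i
      _ = η * L i₀ := div_mul_cancel₀ _ Real.pi_ne_zero
      _ ≤ η * L i := by gcongr; exact hi₀ i
  have hmem {k : ℝ} (hk : k ∈ Set.Icc (k₀ - η) (k₀ + η)) (i : ι) :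
      k * L i - n i * π ∈ Set.Ioo (-(π / 2)) (π / 2) ∧ |Real.tan (k * L i - n i * π) - c i| < ε := by
    refine hη i _ ?_
    have h := abs_lt.mp (hclose i)
    have hl := mul_le_mul_of_nonneg_right hk.1 (hL i).le
    have hu := mul_le_mul_of_nonneg_right hk.2 (hL i).le
    rw [abs_lt]
    constructor <;> linarith
  have hcos {k : ℝ} (hk : k ∈ Set.Icc (k₀ - η) (k₀ + η)) (i : ι) : Real.cos (k * L i) ≠ 0 := by
    have h := (Real.cos_pos_of_mem_Ioo (hmem hk i).1).ne'
    rw [Real.cos_sub_int_mul_pi] at h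
    exact right_ne_zero_of_mul h
  have hleft : ∑ i, Real.tan ((k₀ - η) * L i) ≤ 0 := by
    rw [← hc]
    refine Finset.sum_le_sum fun i _ => ?_
    rw [← Real.tan_sub_int_mul_pi _ (n i), ← Real.tan_arctan (c i)]
    refine Real.strictMonoOn_tan.monotoneOn (hmem ⟨le_rfl, by linarith⟩ i).1 (hθ i) ?_
    change _ ≤ θ i
    linarith [(abs_lt.mp (hclose i)).2]
  have hright : 0 ≤ ∑ i, Real.tan ((k₀ + η) * L i) := by
    rw [← hc]
    refine Finset.sum_le_sum fun i _ => ?_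
    rw [← Real.tan_sub_int_mul_pi _ (n i), ← Real.tan_arctan (c i)]
    refine Real.strictMonoOn_tan.monotoneOn (hθ i) (hmem ⟨by linarith, le_rfl⟩ i).1 ?_
    change θ i ≤ _
    linarith [(abs_lt.mp (hclose i)).1]
  have hcont : ContinuousOn (fun k => ∑ i, Real.tan (k * L i)) (Set.Icc (k₀ - η) (k₀ + η)) :=
    continuousOn_finsetSum _ fun i _ =>
      Real.continuousOn_tan.comp (by fun_prop) fun k hk => hcos hk i
  obtain ⟨k, hk, hk0⟩ := intermediate_value_Icc (by linarith) hcont ⟨hleft, hright⟩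
  refine ⟨k, by linarith [hk.1], hcos hk, hk0, fun i => ?_⟩
  simpa [Real.tan_sub_int_mul_pi] using (hmem hk i).2

lemma sec2_eq_one_add_tan_sq {x : ℝ} (hx : Real.cos x ≠ 0) : sec2 x = 1 + Real.tan x ^ 2 := by
  rw [sec2, inv_pow, ← Real.inv_one_add_tan_sq hx, inv_inv]

/-- Arbitrarily large eigenvalues at which the first `vs` tangents are large and the others are
small. -/
lemma exists_eigenvalue_localised {v : ℕ} {L : Fin v → ℝ} (hL : ∀ i, 0 < L i)
    (hind : LinearIndependent ℚ L) {vs : ℕ} (h1 : 1 < vs) (h2 : vs < v) (r : ℕ) (T : ℝ) :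
    ∃ k, T < k ∧ (∀ i, Real.cos (k * L i) ≠ 0) ∧ ∑ i, Real.tan (k * L i) = 0 ∧
      (∀ i : Fin v, i.val < vs → (r : ℝ) ≤ |Real.tan (k * L i)|) ∧
      ∀ i : Fin v, vs ≤ i.val → |Real.tan (k * L i)| ≤ 1 / ((r : ℝ) + 1) := by
  let w : ℕ → ℝ := fun i => if i < vs then ((if i = 0 then (vs : ℝ) else 0) - 1) * (r + 1) else 0
  have hw : ∑ i : Fin v, w i = 0 := by
    rw [Fin.sum_univ_eq_sum_range w v, ← Finset.sum_subset (Finset.range_mono h2.le) fun i _ hi => by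
      simp only [w, if_neg (by simpa using hi : ¬ i < vs)]]
    calc ∑ i ∈ Finset.range vs, w i
        = ∑ i ∈ Finset.range vs, ((if i = 0 then (vs : ℝ) else 0) - 1) * (r + 1) :=
          Finset.sum_congr rfl fun i hi => if_pos (Finset.mem_range.mp hi)
      _ = 0 := by
          rw [← Finset.sum_mul, Finset.sum_sub_distrib, Finset.sum_ite_eq']
          simp [show 0 < vs by omega]
  have : Nonempty (Fin v) := ⟨⟨0, by omega⟩⟩
  have hr : (0 : ℝ) < r + 1 := by positivity
  obtain ⟨k, hk, hcos, hsum, hnear⟩ :=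
    exists_eigenvalue_tan_near hL hind (fun i => w i) hw (one_div_pos.mpr hr) T
  refine ⟨k, hk, hcos, hsum, fun i hi => ?_, fun i hi => ?_⟩
  · have hle : 1 / ((r : ℝ) + 1) ≤ 1 := by
      rw [div_le_one hr]
      linarith [(r.cast_nonneg : (0 : ℝ) ≤ r)]
    have hvs : (2 : ℝ) ≤ vs := by exact_mod_cast h1
    have hwi : (r : ℝ) + 1 ≤ |w i| := by
      simp only [w, if_pos hi]
      rw [abs_mul, abs_of_pos hr]
      refine le_mul_of_one_le_left hr.le ?_
      split_ifs
      · exact (by linarith : (1 : ℝ) ≤ vs - 1).trans (le_abs_self _)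
      · norm_num
    have := abs_sub_abs_le_abs_sub (w i) (Real.tan (k * L i))
    rw [abs_sub_comm (w i)] at this
    linarith [hnear i]
  · simpa [w, not_lt.mpr hi] using (hnear i).le

/-- For rationally independent bond lengths there is a sequence `κ_r → ∞` of star
graph eigenvalues along which `sec²(κ_r L_i) → ∞` for the bonds `i = 1, …, v*` and
`sec²(κ_r L_i) → 1` for the bonds `i = v*+1, …, v`.  (A 1-based bond label `i`
corresponds to the index `i - 1` of `Fin v`, so the first group is `i.val < vs` and
the second is `vs ≤ i.val`.) -/
theorem eigenvalue_subsequence_localisation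
    (v : ℕ) (hv : 3 ≤ v) (L : Fin v → ℝ) (hL : ∀ i, 0 < L i)
    (hind : LinearIndependent ℚ L) (vs : ℕ) (h1 : 1 < vs) (h2 : vs < v) :
    ∃ κ : ℕ → ℝ, StrictMono κ ∧ (∀ r, 0 < κ r) ∧ Tendsto κ atTop atTop ∧
      (∀ r, ∀ j, Real.cos (κ r * L j) ≠ 0) ∧
      (∀ r, ∑ j, Real.tan (κ r * L j) = 0) ∧
      (∀ i : Fin v, i.val < vs →
        Tendsto (fun r => sec2 (κ r * L i)) atTop atTop) ∧
      (∀ i : Fin v, vs ≤ i.val →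
        Tendsto (fun r => sec2 (κ r * L i)) atTop (𝓝 1)) := by
  choose F hFT hcos hsum hlarge hsmall using
    fun r T => exists_eigenvalue_localised hL hind h1 h2 r T
  let κ : ℕ → ℝ := fun r => Nat.rec (F 0 0) (fun r x => F (r + 1) (max x (r + 1))) r
  have hκ (r : ℕ) : ∃ T : ℝ, (r : ℝ) ≤ T ∧ κ r = F r T := by
    cases r with
    | zero => exact ⟨0, by simp, rfl⟩
    | succ r => exact ⟨max (κ r) (r + 1), by simp, rfl⟩
  have hgt (r : ℕ) : (r : ℝ) < κ r := by
    obtain ⟨T, hT, h⟩ := hκ r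
    exact h ▸ hT.trans_lt (hFT r T)
  have hcosκ (r : ℕ) (j : Fin v) : Real.cos (κ r * L j) ≠ 0 := by
    obtain ⟨T, -, h⟩ := hκ r
    exact h ▸ hcos r T j
  refine ⟨κ, strictMono_nat_of_lt_succ fun r => (le_max_left _ _).trans_lt (hFT _ _),
    fun r => r.cast_nonneg.trans_lt (hgt r),
    tendsto_atTop_mono (fun r => (hgt r).le) tendsto_natCast_atTop_atTop, hcosκ, fun r => ?_,
    fun i hi => ?_, fun i hi => ?_⟩
  · obtain ⟨T, -, h⟩ := hκ r
    exact h ▸ hsum r T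
  · refine tendsto_atTop_mono (fun r => ?_) (tendsto_natCast_atTop_atTop (R := ℝ))
    obtain ⟨T, -, h⟩ := hκ r
    have hr := h ▸ hlarge r T i hi
    rw [sec2_eq_one_add_tan_sq (hcosκ r i), ← sq_abs]
    nlinarith [sq_nonneg (|Real.tan (κ r * L i)| - 1)]
  · have htan : Tendsto (fun r => Real.tan (κ r * L i)) atTop (𝓝 0) := by
      refine squeeze_zero_norm (fun r => ?_) tendsto_one_div_add_atTop_nhds_zero_nat
      obtain ⟨T, -, h⟩ := hκ r
      exact h ▸ hsmall r T i hi
    simp_rw [fun r => sec2_eq_one_add_tan_sq (hcosκ r i)]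
    simpa using (htan.pow 2).const_add 1
end

section
/- Let v ≥ 3 and let L_1,…,L_v > 0 be linearly independent over ℚ. Then there exists a strictly increasing sequence (κ_r) of positive real numbers with κ_r → ∞, each satisfying cos(κ_r·L_j) ≠ 0 for all j and ∑_{j=1}^v tan(κ_r·L_j) = 0, such that sec²(κ_r·L_1) → ∞ and sec²(κ_r·L_2) → ∞, sec²(κ_r·L_i) → 1 for each i = 3,…,v, and additionally sec²(κ_r·L_1)/sec²(κ_r·L_2) → 1 as r → ∞. -/
open scoped Real Topology
open Filter

open MeasureTheory AddCircle

section LinearFlow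

variable {ι : Type*}

/-- The linear flow `t ↦ t • a` on the torus `ℝ^ι / ℤ^ι`. -/
def linearFlow (a : ι → ℝ) (t : ℝ) : UnitAddTorus ι := fun j => ((t * a j : ℝ) : UnitAddCircle)

lemma continuous_linearFlow (a : ι → ℝ) : Continuous (linearFlow a) := by
  unfold linearFlow
  exact continuous_pi fun j => (AddCircle.continuous_mk' 1).comp (by fun_prop)

/-- The average of `f` along the orbit segment `linearFlow a t`, `0 ≤ t ≤ X`. -/
noncomputable def flowAverage (a : ι → ℝ) (X : ℝ) (f : C(UnitAddTorus ι, ℂ)) : ℂ :=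
  (X : ℂ)⁻¹ * ∫ t in (0 : ℝ)..X, f (linearFlow a t)

lemma intervalIntegrable_comp_linearFlow (a : ι → ℝ) (f : C(UnitAddTorus ι, ℂ)) (X Y : ℝ) :
    IntervalIntegrable (fun t => f (linearFlow a t)) volume X Y :=
  (f.continuous.comp (continuous_linearFlow a)).intervalIntegrable X Y

lemma flowAverage_add (a : ι → ℝ) (X : ℝ) (f g : C(UnitAddTorus ι, ℂ)) :
    flowAverage a X (f + g) = flowAverage a X f + flowAverage a X g := by
  simp only [flowAverage, ContinuousMap.add_apply]
  rw [intervalIntegral.integral_add (intervalIntegrable_comp_linearFlow a f 0 X)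
    (intervalIntegrable_comp_linearFlow a g 0 X), mul_add]

lemma flowAverage_smul (a : ι → ℝ) (X : ℝ) (c : ℂ) (f : C(UnitAddTorus ι, ℂ)) :
    flowAverage a X (c • f) = c * flowAverage a X f := by
  simp only [flowAverage, ContinuousMap.smul_apply, smul_eq_mul,
    intervalIntegral.integral_const_mul]
  ring

lemma norm_flowAverage_le (a : ι → ℝ) (X : ℝ) (f : C(UnitAddTorus ι, ℂ)) :
    ‖flowAverage a X f‖ ≤ ‖f‖ := by
  have h : ‖∫ t in (0 : ℝ)..X, f (linearFlow a t)‖ ≤ ‖f‖ * |X - 0| :=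
    intervalIntegral.norm_integral_le_of_norm_le_const fun t _ => f.norm_coe_le_norm _
  rw [sub_zero] at h
  rw [flowAverage, norm_mul, norm_inv, Complex.norm_real, Real.norm_eq_abs]
  rcases eq_or_ne X 0 with rfl | hX
  · simp
  · rw [inv_mul_le_iff₀ (abs_pos.mpr hX)]
    linarith

lemma uniformEquicontinuous_flowAverage (a : ι → ℝ) : UniformEquicontinuous (flowAverage a) := by
  refine LipschitzWith.uniformEquicontinuous (K := 1) _ fun X => LipschitzWith.of_dist_le_mul ?_
  intro f g
  have h : flowAverage a X f - flowAverage a X g = flowAverage a X (f - g) := by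
    rw [sub_eq_add_neg f g, ← neg_one_smul ℂ g, flowAverage_add, flowAverage_smul]
    ring
  rw [dist_eq_norm, dist_eq_norm, h, NNReal.coe_one, one_mul]
  exact norm_flowAverage_le a X _

variable [Fintype ι]

/-- The Haar probability measure on the torus `ℝ^ι / ℤ^ι`. -/
noncomputable def torusHaar (ι : Type*) [Fintype ι] : Measure (UnitAddTorus ι) :=
  Measure.pi fun _ => haarAddCircle

instance : IsProbabilityMeasure (torusHaar ι) := by
  unfold torusHaar; infer_instance

instance : (torusHaar ι).IsOpenPosMeasure := by
  unfold torusHaar; infer_instance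

lemma integral_mFourier_of_ne_zero {n : ι → ℤ} (hn : n ≠ 0) :
    ∫ x, UnitAddTorus.mFourier n x ∂(torusHaar ι) = 0 := by
  obtain ⟨i, hi⟩ := Function.ne_iff.mp hn
  have h := integral_fintype_prod_eq_prod (𝕜 := ℂ)
    (fun (i : ι) (x : UnitAddCircle) => fourier (n i) x) (μ := fun _ => haarAddCircle)
  refine h.trans (Finset.prod_eq_zero (Finset.mem_univ i) ?_)
  exact integral_eq_zero_of_add_right_eq_neg (μ := haarAddCircle)
    (fourier_add_half_inv_index hi one_pos)

lemma mFourier_linearFlow (a : ι → ℝ) (n : ι → ℤ) (t : ℝ) :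
    UnitAddTorus.mFourier n (linearFlow a t) =
      Complex.exp (2 * π * Complex.I * (∑ j, n j * a j : ℝ) * t) := by
  simp only [UnitAddTorus.mFourier, linearFlow, ContinuousMap.coe_mk, fourier_coe_apply,
    ← Complex.exp_sum]
  congr 1
  push_cast
  rw [Finset.mul_sum, Finset.sum_mul]
  exact Finset.sum_congr rfl fun j _ => by ring

lemma tendsto_flowAverage_mFourier {a : ι → ℝ} (ha : LinearIndependent ℚ a) (n : ι → ℤ) :
    Tendsto (fun X => flowAverage a X (UnitAddTorus.mFourier n)) atTop
      (𝓝 (∫ x, UnitAddTorus.mFourier n x ∂(torusHaar ι))) := by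
  rcases eq_or_ne n 0 with rfl | hn
  · rw [UnitAddTorus.mFourier_zero]
    refine tendsto_const_nhds.congr' ?_
    filter_upwards [eventually_gt_atTop 0] with X hX
    have : (X : ℂ) ≠ 0 := by exact_mod_cast hX.ne'
    simp [flowAverage, this]
  · rw [integral_mFourier_of_ne_zero hn]
    have hfreq : (∑ j, n j * a j : ℝ) ≠ 0 := by
      intro h
      refine hn (funext fun j => ?_)
      have := Fintype.linearIndependent_iff.mp ha (fun j => (n j : ℚ))
        (by simpa [Rat.smul_def] using h) j
      exact_mod_cast this
    set c : ℂ := 2 * π * Complex.I * (∑ j, n j * a j : ℝ) with hc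
    have hc0 : c ≠ 0 :=
      mul_ne_zero Complex.two_pi_I_ne_zero (by exact_mod_cast hfreq)
    have hbound : ∀ X : ℝ, ‖flowAverage a X (UnitAddTorus.mFourier n)‖ ≤ |X|⁻¹ * (2 / ‖c‖) := by
      intro X
      have hunit : ‖Complex.exp (c * X)‖ = 1 := by
        rw [hc, ← mFourier_linearFlow]
        simp [UnitAddTorus.mFourier, fourier_apply, norm_prod, -fourier_coe_apply', Circle.norm_coe]
      simp only [flowAverage, mFourier_linearFlow]
      rw [← hc, integral_exp_mul_complex hc0, norm_mul, norm_inv, Complex.norm_real,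
        Real.norm_eq_abs, norm_div]
      gcongr
      refine (norm_sub_le _ _).trans ?_
      rw [hunit]
      norm_num
    refine squeeze_zero_norm hbound ?_
    simpa using (tendsto_inv_atTop_zero.comp tendsto_abs_atTop_atTop).mul_const (2 / ‖c‖)

/-- **Weyl equidistribution** of a linear flow with rationally independent frequencies. -/
theorem tendsto_flowAverage {a : ι → ℝ} (ha : LinearIndependent ℚ a) (f : C(UnitAddTorus ι, ℂ)) :
    Tendsto (fun X => flowAverage a X f) atTop (𝓝 (∫ x, f x ∂(torusHaar ι))) := by
  have hint : ∀ g : C(UnitAddTorus ι, ℂ), Integrable g (torusHaar ι) := fun g =>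
    g.continuous.integrable_of_hasCompactSupport (HasCompactSupport.of_compactSpace g)
  have hcont : Continuous fun g : C(UnitAddTorus ι, ℂ) => ∫ x, g x ∂(torusHaar ι) := by
    refine (LipschitzWith.of_dist_le_mul (K := 1) fun g h => ?_).continuous
    rw [dist_eq_norm, dist_eq_norm, ← integral_sub (hint g) (hint h), NNReal.coe_one, one_mul]
    simpa using norm_integral_le_of_norm_le_const (μ := torusHaar ι)
      (Eventually.of_forall fun x => (g - h).norm_coe_le_norm x)
  have hclosed := (uniformEquicontinuous_flowAverage a).equicontinuous.isClosed_setOfPred_tendsto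
    (l := atTop) hcont
  have hspan : (Submodule.span ℂ (Set.range (UnitAddTorus.mFourier (d := ι))) : Set _) ⊆
      {g | Tendsto (fun X => flowAverage a X g) atTop (𝓝 (∫ x, g x ∂(torusHaar ι)))} := by
    intro g hg
    induction hg using Submodule.span_induction with
    | mem g hg =>
      obtain ⟨n, rfl⟩ := hg
      exact tendsto_flowAverage_mFourier ha n
    | zero => simp [flowAverage]
    | add g h _ _ hg hh =>
      simp only [Set.mem_ofPred_eq, flowAverage_add, ContinuousMap.add_apply]
      rw [integral_add (hint g) (hint h)]
      exact Tendsto.add hg hh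
    | smul c g _ hg =>
      simp only [Set.mem_ofPred_eq, flowAverage_smul, ContinuousMap.smul_apply, smul_eq_mul,
        integral_const_mul]
      exact Tendsto.const_mul c hg
  refine closure_minimal hspan hclosed ?_
  rw [← Submodule.topologicalClosure_coe, UnitAddTorus.span_mFourier_closure_eq_top]
  trivial

/-- **Kronecker's theorem**: a linear flow with rationally independent frequencies enters every
ball of the torus at arbitrarily large times. -/
theorem exists_linearFlow_dist_lt {a : ι → ℝ} (ha : LinearIndependent ℚ a) (θ : UnitAddTorus ι)
    {δ : ℝ} (hδ : 0 < δ) (T : ℝ) : ∃ t > T, dist (linearFlow a t) θ < δ := by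
  by_contra! hfar
  let g : UnitAddTorus ι → ℝ := fun z => max 0 (δ - dist z θ)
  have hg : Continuous g := by fun_prop
  let f : C(UnitAddTorus ι, ℂ) := ⟨fun z => g z, Complex.continuous_ofReal.comp hg⟩
  have hpos : 0 < ∫ z, g z ∂(torusHaar ι) :=
    hg.integral_pos_of_hasCompactSupport_nonneg_nonzero (x := θ)
      (HasCompactSupport.of_compactSpace g) (fun z => le_max_left _ _) (by simp [g, hδ.le, hδ.ne'])
  have hlim := tendsto_flowAverage ha f
  have heq : ∫ z, f z ∂(torusHaar ι) = ((∫ z, g z ∂(torusHaar ι) : ℝ) : ℂ) := integral_ofReal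
  have hzero : Tendsto (fun X => flowAverage a X f) atTop (𝓝 0) := by
    have hinv : Tendsto (fun X : ℝ => ((X⁻¹ : ℝ) : ℂ)) atTop (𝓝 0) := by
      exact (Complex.continuous_ofReal.tendsto' 0 0 Complex.ofReal_zero).comp
        tendsto_inv_atTop_zero
    have h := hinv.mul_const (∫ t in (0 : ℝ)..T, f (linearFlow a t))
    rw [zero_mul] at h
    refine h.congr' ?_
    filter_upwards [eventually_ge_atTop T] with X hX
    have hvanish : ∫ t in T..X, f (linearFlow a t) = 0 := by
      refine intervalIntegral.integral_zero_ae (Eventually.of_forall fun t ht => ?_)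
      rw [Set.uIoc_of_le hX] at ht
      simpa [f, g] using hfar t ht.1
    rw [flowAverage, ← intervalIntegral.integral_add_adjacent_intervals
      (intervalIntegrable_comp_linearFlow a f 0 T) (intervalIntegrable_comp_linearFlow a f T X),
      hvanish, add_zero, Complex.ofReal_inv]
  have := tendsto_nhds_unique hlim hzero
  rw [heq] at this
  exact hpos.ne' (by exact_mod_cast this)

end LinearFlow

section StarGraph

variable {ι : Type*} [Fintype ι]

/-- **Kronecker's theorem**, with phases taken modulo `π`. -/
theorem exists_gt_abs_sub_add_int_mul_pi_lt {L : ι → ℝ} (hL : LinearIndependent ℚ L) (θ : ι → ℝ)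
    {δ : ℝ} (hδ : 0 < δ) (T : ℝ) :
    ∃ k > T, ∃ n : ι → ℤ, ∀ j, |k * L j - (θ j + n j * π)| < δ := by
  obtain ⟨t, ht, hdist⟩ := exists_linearFlow_dist_lt hL
    (fun j => ((θ j / π : ℝ) : UnitAddCircle)) (div_pos hδ Real.pi_pos) (T / π)
  refine ⟨t * π, (div_lt_iff₀ Real.pi_pos).mp ht, fun j => round (t * L j - θ j / π), fun j => ?_⟩
  have h := (dist_pi_lt_iff (div_pos hδ Real.pi_pos)).mp hdist j
  rw [dist_eq_norm, linearFlow, ← QuotientAddGroup.mk_sub, UnitAddCircle.norm_eq,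
    lt_div_iff₀ Real.pi_pos] at h
  convert! h using 1
  rw [← abs_of_pos Real.pi_pos, ← abs_mul, abs_of_pos Real.pi_pos]
  congr 1
  field_simp
  ring

/-- Near any point of the secular hypersurface `∑ tan θ_j = 0` of the torus there are
arbitrarily large star graph eigenvalues. -/
theorem exists_eigenvalue_near [Nonempty ι] {L : ι → ℝ} (hpos : ∀ j, 0 < L j)
    (hL : LinearIndependent ℚ L) {θ : ι → ℝ} (hcos : ∀ j, Real.cos (θ j) ≠ 0)
    (hsum : ∑ j, Real.tan (θ j) = 0) {η : ℝ} (hη : 0 < η) (T : ℝ) :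
    ∃ k > T, (∀ j, Real.cos (k * L j) ≠ 0) ∧ ∑ j, Real.tan (k * L j) = 0 ∧
      ∃ n : ι → ℤ, ∀ j, |k * L j - (θ j + n j * π)| < η := by
  let G : (ι → ℝ) → ℝ := fun y => ∑ j, Real.tan (y j)
  have hGcont : ∀ y : ι → ℝ, (∀ j, Real.cos (y j) ≠ 0) → ContinuousAt G y := fun y hy =>
    tendsto_finsetSum _ fun j _ =>
      (Real.continuousAt_tan.mpr (hy j)).comp (f := fun y : ι → ℝ => y j)
        (continuous_apply j).continuousAt
  obtain ⟨ρ, hρ, hρcos⟩ : ∃ ρ > 0, ∀ y : ι → ℝ, dist y θ < ρ → ∀ j, Real.cos (y j) ≠ 0 := by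
    refine Metric.eventually_nhds_iff.mp (eventually_all.mpr fun j => ?_)
    exact ((Real.continuous_cos.comp (continuous_apply j)).continuousAt).eventually_ne (hcos j)
  have hderiv : HasDerivAt (fun t : ℝ => G (θ + t • L))
      (∑ j, 1 / Real.cos (θ j) ^ 2 * L j) 0 := by
    refine HasDerivAt.fun_sum fun j _ => ?_
    have h₁ : HasDerivAt (fun t : ℝ => θ j + t * L j) (L j) 0 := by
      simpa using ((hasDerivAt_id (0 : ℝ)).mul_const (L j)).const_add (θ j)
    have h₂ : HasDerivAt Real.tan (1 / Real.cos (θ j) ^ 2) (θ j + 0 * L j) := by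
      simpa using Real.hasDerivAt_tan (hcos j)
    exact h₂.comp 0 h₁
  have hderiv_pos : 0 < deriv (fun t : ℝ => G (θ + t • L)) 0 := by
    rw [hderiv.deriv]
    refine Finset.sum_pos (fun j _ => ?_) Finset.univ_nonempty
    have := hcos j
    have := hpos j
    positivity
  have hsign := eventually_nhdsWithin_sign_eq_of_deriv_pos hderiv_pos (by simpa [G] using hsum)
  set r := min ρ η / 2 with hr
  have hr0 : 0 < r := half_pos (lt_min hρ hη)
  have hsmall : ∀ᶠ t : ℝ in 𝓝 0, ‖t • L‖ < r := by
    have : Tendsto (fun t : ℝ => ‖t • L‖) (𝓝 0) (𝓝 0) := by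
      simpa using (show Continuous fun t : ℝ => ‖t • L‖ by fun_prop).tendsto 0
    exact this.eventually_lt_const hr0
  obtain ⟨ε, hε, hball⟩ := Metric.eventually_nhds_iff.mp (hsign.and hsmall)
  obtain ⟨h, hh0, hhε⟩ := exists_between hε
  have hh := hball (y := h) (by simpa [abs_of_pos hh0] using hhε)
  have hh' := hball (y := -h) (by simpa [abs_of_pos hh0] using hhε)
  have hupper : 0 < G (θ + h • L) := by
    have := hh.1
    rwa [sub_zero, sign_pos hh0, sign_eq_one_iff] at this
  have hlower : G (θ + (-h) • L) < 0 := by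
    have := hh'.1
    rwa [sub_zero, sign_neg (neg_lt_zero.mpr hh0), sign_eq_neg_one_iff] at this
  have hshift : ∀ t : ℝ, |t| ≤ h → ‖t • L‖ < r := fun t ht => by
    refine lt_of_le_of_lt ?_ hh.2
    rw [norm_smul, norm_smul, Real.norm_eq_abs, Real.norm_eq_abs, abs_of_pos hh0]
    gcongr
  have hcont : ∀ t : ℝ, |t| ≤ h → ∀ y : ι → ℝ, dist y θ < r →
      dist (y + t • L) θ < min ρ η := fun t ht y hy => by
    calc dist (y + t • L) θ ≤ dist (y + t • L) y + dist y θ := dist_triangle _ _ _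
      _ < r + r := by
        refine add_lt_add ?_ hy
        simpa [dist_eq_norm] using hshift t ht
      _ = min ρ η := by rw [hr]; ring
  have hnear : ∀ t : ℝ, |t| ≤ h → ContinuousAt (fun y => G (y + t • L)) θ := fun t ht => by
    have hc : ContinuousAt G (θ + t • L) :=
      hGcont _ (hρcos _ ((hcont t ht θ (by simpa using hr0)).trans_le (min_le_left _ _)))
    exact hc.comp (f := fun y : ι → ℝ => y + t • L) (by fun_prop)
  have habs : |h| ≤ h := (abs_of_pos hh0).le
  have habs' : |-h| ≤ h := by rwa [abs_neg]
  obtain ⟨δ, hδ, hδball⟩ := Metric.eventually_nhds_iff.mp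
    (((hnear h habs).eventually (lt_mem_nhds hupper)).and
      ((hnear (-h) habs').eventually (gt_mem_nhds hlower)))
  obtain ⟨k, hk, n, hn⟩ := exists_gt_abs_sub_add_int_mul_pi_lt hL θ (lt_min hδ hr0) (T + h)
  let y : ι → ℝ := fun j => k * L j - n j * π
  have hy : dist y θ < min δ r := by
    refine (dist_pi_lt_iff (lt_min hδ hr0)).mpr fun j => ?_
    rw [Real.dist_eq]
    convert! hn j using 2
    ring
  have hyr := hy.trans_le (min_le_right _ _)
  have hysign := hδball (hy.trans_le (min_le_left _ _))
  have hcontOn : ContinuousOn (fun t : ℝ => G (y + t • L)) (Set.Icc (-h) h) := fun t ht => by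
    have hc : ContinuousAt G (y + t • L) :=
      hGcont _ (hρcos _ ((hcont t (abs_le.mpr ht) y hyr).trans_le (min_le_left _ _)))
    exact (hc.comp (f := fun t : ℝ => y + t • L) (by fun_prop)).continuousWithinAt
  obtain ⟨t, ht, hroot⟩ := intermediate_value_Icc (by linarith) hcontOn
    ⟨hysign.2.le, hysign.1.le⟩
  have hclose := hcont t (abs_le.mpr ht) y hyr
  have hcoord : ∀ j, (k + t) * L j = (y + t • L) j + n j * π := fun j => by
    simp only [y, Pi.add_apply, Pi.smul_apply, smul_eq_mul]
    ring
  refine ⟨k + t, by linarith [ht.1], fun j => ?_, ?_, n, fun j => ?_⟩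
  · rw [hcoord, Real.cos_add_int_mul_pi]
    exact mul_ne_zero (zpow_ne_zero _ (by norm_num))
      (hρcos _ (hclose.trans_le (min_le_left _ _)) j)
  · simpa only [hcoord, Real.tan_add_int_mul_pi] using hroot
  · have := (dist_pi_lt_iff (lt_min hρ hη)).mp hclose j
    rw [hcoord, add_sub_add_right_eq_sub]
    exact this.trans_le (min_le_right _ _)

lemma sec2_add_int_mul_pi (x : ℝ) (n : ℤ) : sec2 (x + n * π) = sec2 x := by
  rw [sec2, sec2, Real.cos_add_int_mul_pi, inv_pow, inv_pow, mul_pow, ← zpow_natCast,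
    ← zpow_mul, mul_comm n, zpow_mul]
  norm_num

lemma continuousAt_sec2 {x : ℝ} (hx : Real.cos x ≠ 0) : ContinuousAt sec2 x :=
  (Real.continuous_cos.continuousAt.inv₀ hx).pow 2

/-- Star graph eigenvalues realise, up to any error, the values of `sec²` at any point of the
secular hypersurface. -/
theorem exists_eigenvalue_abs_sec2_sub_lt [Nonempty ι] {L : ι → ℝ} (hpos : ∀ j, 0 < L j)
    (hL : LinearIndependent ℚ L) {θ : ι → ℝ} (hcos : ∀ j, Real.cos (θ j) ≠ 0)
    (hsum : ∑ j, Real.tan (θ j) = 0) {ε : ℝ} (hε : 0 < ε) (T : ℝ) :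
    ∃ k > T, (∀ j, Real.cos (k * L j) ≠ 0) ∧ ∑ j, Real.tan (k * L j) = 0 ∧
      ∀ j, |sec2 (k * L j) - sec2 (θ j)| < ε := by
  obtain ⟨η, hη, hball⟩ : ∃ η > 0, ∀ y : ι → ℝ, dist y θ < η →
      ∀ j, |sec2 (y j) - sec2 (θ j)| < ε := by
    refine Metric.eventually_nhds_iff.mp (eventually_all.mpr fun j => ?_)
    have hc : ContinuousAt (fun y : ι → ℝ => sec2 (y j)) θ :=
      (continuousAt_sec2 (hcos j)).comp (f := fun y : ι → ℝ => y j)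
        (continuous_apply j).continuousAt
    exact hc.eventually (Metric.ball_mem_nhds _ hε)
  obtain ⟨k, hk, hkcos, hksum, n, hn⟩ := exists_eigenvalue_near hpos hL hcos hsum hη T
  refine ⟨k, hk, hkcos, hksum, fun j => ?_⟩
  have hy := hball (fun j => k * L j - n j * π) ((dist_pi_lt_iff hη).mpr fun j => by
    rw [Real.dist_eq]
    convert! hn j using 2
    ring) j
  rwa [← sec2_add_int_mul_pi _ (n j), sub_add_cancel] at hy

end StarGraph

lemma inv_sq_le_sec2_pi_div_two_sub {x : ℝ} (hx : Real.sin x ≠ 0) :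
    (x ^ 2)⁻¹ ≤ sec2 (π / 2 - x) := by
  rw [sec2, Real.cos_pi_div_two_sub, inv_pow]
  exact inv_anti₀ (by positivity) (sq_le_sq.mpr Real.abs_sin_le_abs)

/-- For rationally independent bond lengths there is a sequence `κ_r → ∞` of star
graph eigenvalues along which `sec²(κ_r L_1), sec²(κ_r L_2) → ∞` with
`sec²(κ_r L_1)/sec²(κ_r L_2) → 1`, while `sec²(κ_r L_i) → 1` for `i = 3, …, v`.
(Bonds `1` and `2` are the indices `0` and `1` of `Fin v`.) -/
theorem eigenvalue_subsequence_two_bonds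
    (v : ℕ) (hv : 3 ≤ v) (L : Fin v → ℝ) (hL : ∀ i, 0 < L i)
    (hind : LinearIndependent ℚ L) :
    ∃ κ : ℕ → ℝ, StrictMono κ ∧ (∀ r, 0 < κ r) ∧ Tendsto κ atTop atTop ∧
      (∀ r, ∀ j, Real.cos (κ r * L j) ≠ 0) ∧
      (∀ r, ∑ j, Real.tan (κ r * L j) = 0) ∧
      Tendsto (fun r => sec2 (κ r * L ⟨0, by omega⟩)) atTop atTop ∧
      Tendsto (fun r => sec2 (κ r * L ⟨1, by omega⟩)) atTop atTop ∧
      (∀ i : Fin v, 2 ≤ i.val →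
        Tendsto (fun r => sec2 (κ r * L i)) atTop (𝓝 1)) ∧
      Tendsto (fun r => sec2 (κ r * L ⟨0, by omega⟩) / sec2 (κ r * L ⟨1, by omega⟩))
        atTop (𝓝 1) := by
  set i₀ : Fin v := ⟨0, by omega⟩
  set i₁ : Fin v := ⟨1, by omega⟩
  have h01 : i₀ ≠ i₁ := by simp [i₀, i₁]
  have : Nonempty (Fin v) := ⟨i₀⟩
  let e : ℕ → ℝ := fun r => 1 / ((r : ℝ) + 1)
  have he0 : ∀ r, 0 < e r := fun r => Nat.one_div_pos_of_nat
  have he1 : ∀ r, e r ≤ 1 := fun r => by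
    simpa [e] using Nat.one_div_le_one_div (α := ℝ) (Nat.zero_le r)
  have helim : Tendsto e atTop (𝓝 0) := tendsto_one_div_add_atTop_nhds_zero_nat
  have hsin : ∀ r, 0 < Real.sin (e r) := fun r =>
    Real.sin_pos_of_pos_of_lt_pi (he0 r) ((he1 r).trans_lt (by linarith [Real.pi_gt_three]))
  let θ : ℕ → Fin v → ℝ := fun r j =>
    if j = i₀ then π / 2 - e r else if j = i₁ then -(π / 2 - e r) else 0
  have hθ₀ : ∀ r, θ r i₀ = π / 2 - e r := fun r => by simp [θ]
  have hθ₁ : ∀ r, θ r i₁ = -(π / 2 - e r) := fun r => by simp [θ, h01.symm]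
  have hθ : ∀ r j, j ≠ i₀ → j ≠ i₁ → θ r j = 0 := fun r j h₀ h₁ => by simp [θ, h₀, h₁]
  have hcos : ∀ r j, Real.cos (θ r j) ≠ 0 := fun r j => by
    by_cases h₀ : j = i₀
    · rw [h₀, hθ₀, Real.cos_pi_div_two_sub]
      exact (hsin r).ne'
    by_cases h₁ : j = i₁
    · rw [h₁, hθ₁, Real.cos_neg, Real.cos_pi_div_two_sub]
      exact (hsin r).ne'
    · simp [hθ r j h₀ h₁]
  have hsum : ∀ r, ∑ j, Real.tan (θ r j) = 0 := fun r => by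
    rw [Fintype.sum_eq_add i₀ i₁ h01 fun j hj => by rw [hθ r j hj.1 hj.2, Real.tan_zero],
      hθ₀, hθ₁, Real.tan_neg, add_neg_cancel]
  choose! K hKgt hKcos hKsum hKsec using fun (r : ℕ) (T : ℝ) =>
    exists_eigenvalue_abs_sec2_sub_lt hL hind (hcos r) (hsum r) (he0 r) T
  let κ : ℕ → ℝ := fun r => Nat.rec (K 0 0) (fun s x => K (s + 1) (max x (s + 1))) r
  have hκ : ∀ r, ∃ T, κ r = K r T := fun r => by
    cases r with
    | zero => exact ⟨0, rfl⟩
    | succ s => exact ⟨max (κ s) (s + 1), rfl⟩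
  have hmono : StrictMono κ := strictMono_nat_of_lt_succ fun s =>
    (le_max_left _ _).trans_lt (hKgt (s + 1) (max (κ s) (s + 1)))
  have hge : ∀ r : ℕ, (r : ℝ) ≤ κ r := fun r => by
    cases r with
    | zero => exact_mod_cast (hKgt 0 0).le
    | succ s =>
      push_cast
      exact (le_max_right _ _).trans (hKgt (s + 1) (max (κ s) (s + 1))).le
  have hsec : ∀ r j, |sec2 (κ r * L j) - sec2 (θ r j)| < e r := fun r => by
    obtain ⟨T, hT⟩ := hκ r
    rw [hT]
    exact hKsec r T
  have hsecEq : ∀ r, sec2 (θ r i₁) = sec2 (θ r i₀) := fun r => by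
    rw [hθ₀, hθ₁, sec2, sec2, Real.cos_neg]
  have hsecBig : Tendsto (fun r => sec2 (θ r i₀) - 1) atTop atTop := by
    refine tendsto_atTop_mono (f := fun r : ℕ => (r : ℝ)) (fun r => ?_) tendsto_natCast_atTop_atTop
    have h := inv_sq_le_sec2_pi_div_two_sub (hsin r).ne'
    rw [← hθ₀] at h
    have he : (e r ^ 2)⁻¹ = ((r : ℝ) + 1) ^ 2 := by simp [e]
    nlinarith [(Nat.cast_nonneg r : (0 : ℝ) ≤ r)]
  have hbig₀ : Tendsto (fun r => sec2 (κ r * L i₀)) atTop atTop :=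
    tendsto_atTop_mono (fun r => by
      linarith [(abs_lt.mp (hsec r i₀)).1, he1 r]) hsecBig
  have hbig₁ : Tendsto (fun r => sec2 (κ r * L i₁)) atTop atTop :=
    tendsto_atTop_mono (fun r => by
      linarith [(abs_lt.mp (hsec r i₁)).1, he1 r, hsecEq r]) hsecBig
  refine ⟨κ, hmono, fun r => (hKgt 0 0).trans_le (hmono.monotone (Nat.zero_le r)),
    tendsto_atTop_mono hge tendsto_natCast_atTop_atTop, fun r => ?_, fun r => ?_,
    hbig₀, hbig₁, fun i hi => ?_, ?_⟩
  · obtain ⟨T, hT⟩ := hκ r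
    rw [hT]
    exact hKcos r T
  · obtain ⟨T, hT⟩ := hκ r
    rw [hT]
    exact hKsum r T
  · have h₀ : i ≠ i₀ := fun h => by simp [h, i₀] at hi
    have h₁ : i ≠ i₁ := fun h => by simp [h, i₁] at hi
    rw [tendsto_iff_dist_tendsto_zero]
    refine squeeze_zero (fun _ => dist_nonneg) (fun r => ?_) helim
    have h := hsec r i
    rw [hθ r i h₀ h₁] at h
    simpa [sec2, Real.dist_eq] using h.le
  · rw [tendsto_iff_dist_tendsto_zero]
    refine squeeze_zero' (Eventually.of_forall fun _ => dist_nonneg) ?_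
      (g := fun r => 2 * e r) (by simpa using helim.const_mul 2)
    filter_upwards [hbig₁.eventually_ge_atTop 1] with r hr
    rw [Real.dist_eq, div_sub_one (by linarith), abs_div, abs_of_pos (zero_lt_one.trans_le hr)]
    refine (div_le_self (abs_nonneg _) hr).trans ?_
    have h₀ := abs_lt.mp (hsec r i₀)
    have h₁ := abs_lt.mp (hsec r i₁)
    rw [hsecEq] at h₁
    exact abs_le.mpr ⟨by linarith, by linarith⟩
end

section
/- Fix a real η > 0 and an integer α ≥ 1. Then: (a) Re(τ_η'(ξ)) ≥ 0 for every ξ > 0, where τ_η' is the derivative of τ_η; and (b) Re(τ_η(ξ)) ≥ √(2/π)·(√η + α − 1) > 0 for every ξ ∈ ℝ. -/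
open scoped Real Topology
open Filter

/-- `P_η(ξ)`. -/
noncomputable def Pfun (a : ℕ) (η ξ : ℝ) : ℂ :=
  (Real.sqrt (Real.pi * η) : ℂ)⁻¹ * Complex.exp (Complex.I * (ξ ^ 2 / (4 * η) - Real.pi / 4))
  + ((a : ℂ) - 1) / (Real.sqrt Real.pi : ℂ) *
      Complex.exp (Complex.I * (Real.pi / 4 - ξ ^ 2 / 4))

/-- `τ_η(ξ)`. -/
noncomputable def taufun (a : ℕ) (η ξ : ℝ) : ℂ :=
  2 * Real.sqrt η / Real.sqrt Real.pi * Complex.exp (Complex.I * (Real.pi / 4 + ξ ^ 2 / (4 * η)))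
  + ξ * cerf (Complex.exp (-(Complex.I * (Real.pi / 4))) * ξ / (2 * Real.sqrt η))
  + 2 * ((a : ℂ) - 1) / Real.sqrt Real.pi *
      Complex.exp (-(Complex.I * (Real.pi / 4 + ξ ^ 2 / 4)))
  + ξ * ((a : ℂ) - 1) * cerf (Complex.exp (Complex.I * (Real.pi / 4)) * ξ / 2)

open Complex in
/-- Rescaling the segment parametrisation of `cerf`. -/
lemma cerf_mul_ofReal (c : ℂ) (s : ℝ) :
    cerf (c * s) = 2 / √π * (c * ∫ u in (0:ℝ)..s, exp (-(c * u) ^ 2)) := by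
  have h := intervalIntegral.smul_integral_comp_mul_right (a := 0) (b := 1)
    (fun u : ℝ => exp (-(c * u) ^ 2)) s
  simp only [zero_mul, one_mul, real_smul] at h
  rw [cerf, ← h, mul_assoc c]
  simp only [ofReal_mul, mul_left_comm]

lemma cerf_neg (z : ℂ) : cerf (-z) = -cerf z := by
  simp [cerf]

lemma hasDerivAt_cerf_mul_ofReal (c : ℂ) (s : ℝ) :
    HasDerivAt (fun t : ℝ => cerf (c * t)) (2 / √π * (c * Complex.exp (-(c * s) ^ 2))) s := by
  have hcont : Continuous fun u : ℝ => Complex.exp (-(c * u) ^ 2) := by fun_prop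
  simp only [cerf_mul_ofReal]
  exact (((hcont.integral_hasStrictDerivAt 0 s).hasDerivAt).const_mul c).const_mul _

/-- An explicit antiderivative of `s ↦ cerf (c * s)`. -/
lemma hasDerivAt_antideriv_cerf {c : ℂ} (hc : c ≠ 0) (s : ℝ) :
    HasDerivAt (fun t : ℝ => (c * √π)⁻¹ * Complex.exp (-(c * t) ^ 2) + t * cerf (c * t))
      (cerf (c * s)) s := by
  have hid : HasDerivAt (fun t : ℝ => (t : ℂ)) 1 s := Complex.ofRealCLM.hasDerivAt
  have hexp := ((((hid.const_mul c).pow 2).neg).cexp).const_mul (c * (√π : ℂ))⁻¹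
  have hpi : (√π : ℂ) ≠ 0 := by
    exact_mod_cast (Real.sqrt_pos.2 Real.pi_pos).ne'
  refine (hexp.add (hid.mul (hasDerivAt_cerf_mul_ofReal c s))).congr_deriv ?_
  simp only [Pi.pow_apply, Pi.neg_apply]
  field_simp
  ring

/-- The integral of `cos u² + sin u²` over `[0, s]` is nonnegative. -/
lemma integral_cos_sq_add_sin_sq_nonneg {s : ℝ} (hs : 0 ≤ s) :
    0 ≤ ∫ u in (0:ℝ)..s, (Real.cos (u ^ 2) + Real.sin (u ^ 2)) := by
  have hcont : Continuous fun u : ℝ => Real.cos (u ^ 2) + Real.sin (u ^ 2) := by fun_prop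
  have hlow : ∀ s : ℝ, 0 ≤ s → s ≤ √(π / 2) →
      s ≤ ∫ u in (0:ℝ)..s, (Real.cos (u ^ 2) + Real.sin (u ^ 2)) := by
    intro s hs hs'
    have hmono := intervalIntegral.integral_mono_on (a := 0) (b := s) (μ := MeasureTheory.volume)
      (f := fun _ => (1 : ℝ)) hs intervalIntegrable_const
      (hcont.intervalIntegrable 0 s) (fun u hu => ?_)
    · simpa using hmono
    have hu2 : u ^ 2 ≤ π / 2 := (Real.le_sqrt hu.1 (by positivity)).1 (hu.2.trans hs')
    have hcos : 0 ≤ Real.cos (u ^ 2) := Real.cos_nonneg_of_neg_pi_div_two_le_of_le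
      (by nlinarith [Real.pi_pos, sq_nonneg u]) hu2
    have hsin : 0 ≤ Real.sin (u ^ 2) := Real.sin_nonneg_of_nonneg_of_le_pi
      (sq_nonneg u) (by linarith [Real.pi_pos])
    nlinarith [Real.sin_sq_add_cos_sq (u ^ 2), mul_nonneg hcos hsin]
  rcases le_total s √(π / 2) with h | h
  · exact hs.trans (hlow s hs h)
  have hr : 0 < √(π / 2) := Real.sqrt_pos.2 (by positivity)
  have hbound : ∀ x : ℝ, 0 ≤ √2 + Real.sin x - Real.cos x := by
    intro x
    have := Real.abs_le_sqrt (x := Real.cos x - Real.sin x) (y := 2)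
      (by nlinarith [Real.sin_sq_add_cos_sq x, sq_nonneg (Real.cos x + Real.sin x)])
    linarith [le_abs_self (Real.cos x - Real.sin x)]
  let H : ℝ → ℝ := fun t => (∫ u in (0:ℝ)..t, (Real.cos (u ^ 2) + Real.sin (u ^ 2)))
    - (√2 + Real.sin (t ^ 2) - Real.cos (t ^ 2)) / (2 * t)
  have hderiv : ∀ t : ℝ, 0 < t → HasDerivAt H
      ((√2 + Real.sin (t ^ 2) - Real.cos (t ^ 2)) / (2 * t ^ 2)) t := by
    intro t ht
    have hsq := hasDerivAt_pow 2 t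
    have hnum := ((hsq.sin.const_add √2).sub hsq.cos).div
      ((hasDerivAt_id t).const_mul 2) (by simpa using ht.ne')
    refine ((hcont.integral_hasStrictDerivAt 0 t).hasDerivAt.sub hnum).congr_deriv ?_
    simp
    field_simp
    ring
  have hmono : MonotoneOn H (Set.Ici √(π / 2)) := by
    refine monotoneOn_of_deriv_nonneg (convex_Ici _)
      (fun t ht => (hderiv t (hr.trans_le ht)).continuousAt.continuousWithinAt) ?_ ?_
    · intro t ht
      rw [interior_Ici] at ht
      exact (hderiv t (hr.trans ht)).differentiableAt.differentiableWithinAt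
    · intro t ht
      rw [interior_Ici] at ht
      rw [(hderiv t (hr.trans ht)).deriv]
      exact div_nonneg (hbound _) (by positivity)
  have hstart : 0 ≤ H √(π / 2) := by
    have hsq : √(π / 2) ^ 2 = π / 2 := Real.sq_sqrt (by positivity)
    have hle : (√2 + 1) / (2 * √(π / 2)) ≤ √(π / 2) := by
      rw [div_le_iff₀ (by positivity)]
      nlinarith [Real.pi_gt_three, Real.sq_sqrt (zero_le_two (α := ℝ)), Real.sqrt_nonneg 2]
    have := hlow _ hr.le le_rfl
    simp only [H, hsq, Real.sin_pi_div_two, Real.cos_pi_div_two, sub_zero]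
    linarith
  have hH := hstart.trans (hmono Set.self_mem_Ici h h)
  have : 0 ≤ (√2 + Real.sin (s ^ 2) - Real.cos (s ^ 2)) / (2 * s) :=
    div_nonneg (hbound _) (by linarith)
  simp only [H] at hH
  linarith

/-- `cerf` has nonnegative real part on the rays of argument `±π/4`. -/
lemma cerf_re_nonneg {σ : ℝ} (hσ : σ ^ 2 = 1) {k s : ℝ} (hk : 0 ≤ k) (hs : 0 ≤ s) :
    0 ≤ (cerf (k * (1 + σ * Complex.I) * s)).re := by
  set x : ℝ := √2 * k * s with hx
  have hx0 : 0 ≤ x := by positivity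
  have h2 : (√2 : ℂ) ^ 2 = 2 := by
    exact_mod_cast Real.sq_sqrt (zero_le_two (α := ℝ))
  have h2' : (√2 : ℂ) ≠ 0 := by
    intro h
    simp [h] at h2
  have hσ' : (σ : ℂ) ^ 2 = 1 := by exact_mod_cast hσ
  have harg : (k * (1 + σ * Complex.I) * s : ℂ) = (1 + σ * Complex.I) / √2 * x := by
    rw [hx]
    push_cast
    field_simp
  have hint : ∀ u : ℝ, (1 + σ * Complex.I) * Complex.exp (-((1 + σ * Complex.I) / √2 * u) ^ 2)
      = ((Real.cos (u ^ 2) + Real.sin (u ^ 2) : ℝ) : ℂ)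
        + ((σ * (Real.cos (u ^ 2) - Real.sin (u ^ 2)) : ℝ) : ℂ) * Complex.I := by
    intro u
    have hsq : -((1 + σ * Complex.I) / √2 * u) ^ 2 = ((-σ * u ^ 2 : ℝ) : ℂ) * Complex.I := by
      rw [mul_pow, div_pow, h2]
      push_cast
      linear_combination (-(u : ℂ) ^ 2 / 2) * (σ ^ 2 * Complex.I_sq - hσ')
    have hcos : Real.cos (-σ * u ^ 2) = Real.cos (u ^ 2) := by
      rcases eq_or_eq_neg_of_sq_eq_sq σ 1 (by simpa using hσ) with h | h <;> simp [h]
    have hsin : Real.sin (-σ * u ^ 2) = -σ * Real.sin (u ^ 2) := by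
      rcases eq_or_eq_neg_of_sq_eq_sq σ 1 (by simpa using hσ) with h | h <;> simp [h]
    rw [hsq, Complex.exp_mul_I, ← Complex.ofReal_cos, ← Complex.ofReal_sin, hcos, hsin]
    push_cast
    linear_combination (-(σ : ℂ) ^ 2 * Complex.sin (u ^ 2)) * Complex.I_sq
      + Complex.sin (u ^ 2) * hσ'
  have hval : cerf (k * (1 + σ * Complex.I) * s)
      = ((2 / √π / √2 : ℝ) : ℂ) *
        (((∫ u in (0:ℝ)..x, (Real.cos (u ^ 2) + Real.sin (u ^ 2)) : ℝ) : ℂ)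
        + ((∫ u in (0:ℝ)..x, (σ * (Real.cos (u ^ 2) - Real.sin (u ^ 2))) : ℝ) : ℂ)
          * Complex.I) := by
    rw [harg, cerf_mul_ofReal, div_mul_eq_mul_div (1 + σ * Complex.I),
      ← intervalIntegral.integral_const_mul]
    simp only [hint]
    rw [intervalIntegral.integral_add, intervalIntegral.integral_mul_const,
      intervalIntegral.integral_ofReal, intervalIntegral.integral_ofReal]
    · push_cast
      ring
    all_goals
      apply Continuous.intervalIntegrable
      fun_prop
  rw [hval, Complex.re_ofReal_mul]
  refine mul_nonneg (by positivity) ?_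
  simpa using integral_cos_sq_add_sin_sq_nonneg hx0

lemma exp_pi_div_four_mul_I :
    Complex.exp (Complex.I * (π / 4)) = (√2 / 2 : ℝ) * (1 + (1 : ℝ) * Complex.I) := by
  rw [mul_comm, show (π / 4 : ℂ) = ((π / 4 : ℝ) : ℂ) by push_cast; rfl, Complex.exp_mul_I,
    ← Complex.ofReal_cos, ← Complex.ofReal_sin, Real.cos_pi_div_four, Real.sin_pi_div_four]
  push_cast
  ring

lemma exp_neg_pi_div_four_mul_I :
    Complex.exp (-(Complex.I * (π / 4))) = (√2 / 2 : ℝ) * (1 + (-1 : ℝ) * Complex.I) := by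
  rw [mul_comm, show -((π / 4 : ℂ) * Complex.I) = ((-(π / 4) : ℝ) : ℂ) * Complex.I by
    push_cast; ring, Complex.exp_mul_I, ← Complex.ofReal_cos, ← Complex.ofReal_sin,
    Real.cos_neg, Real.sin_neg, Real.cos_pi_div_four, Real.sin_pi_div_four]
  push_cast
  ring

lemma hasDerivAt_taufun (a : ℕ) {η : ℝ} (hη : 0 < η) (ξ : ℝ) :
    HasDerivAt (fun t : ℝ => taufun a η t)
      (cerf (Complex.exp (-(Complex.I * (π / 4))) / (2 * √η) * ξ)
        + (((a : ℝ) - 1 : ℝ) : ℂ) * cerf (Complex.exp (Complex.I * (π / 4)) / 2 * ξ)) ξ := by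
  have hη' : (√η : ℂ) ≠ 0 := by exact_mod_cast (Real.sqrt_pos.2 hη).ne'
  have hη2 : (√η : ℂ) ^ 2 = η := by exact_mod_cast Real.sq_sqrt hη.le
  have hη0 : (η : ℂ) ≠ 0 := by exact_mod_cast hη.ne'
  have hpi : (√π : ℂ) ≠ 0 := by exact_mod_cast (Real.sqrt_pos.2 Real.pi_pos).ne'
  have hc₁ : Complex.exp (-(Complex.I * (π / 4))) / (2 * √η) ≠ 0 :=
    div_ne_zero (Complex.exp_ne_zero _) (mul_ne_zero two_ne_zero hη')
  have hc₂ : Complex.exp (Complex.I * (π / 4)) / 2 ≠ 0 :=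
    div_ne_zero (Complex.exp_ne_zero _) two_ne_zero
  refine ((hasDerivAt_antideriv_cerf hc₁ ξ).add
    ((hasDerivAt_antideriv_cerf hc₂ ξ).const_mul _)).congr_of_eventuallyEq
    (Eventually.of_forall fun t => ?_)
  have hsq₁ : Complex.exp (-(Complex.I * (π / 4))) ^ 2 = -Complex.I := by
    rw [← Complex.exp_nat_mul, show ((2 : ℕ) : ℂ) * -(Complex.I * (π / 4))
      = -(π / 2 * Complex.I) by push_cast; ring, Complex.exp_neg, Complex.exp_pi_div_two_mul_I,
      Complex.inv_I]
  have hsq₂ : Complex.exp (Complex.I * (π / 4)) ^ 2 = Complex.I := by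
    rw [← Complex.exp_nat_mul, show ((2 : ℕ) : ℂ) * (Complex.I * (π / 4))
      = π / 2 * Complex.I by push_cast; ring, Complex.exp_pi_div_two_mul_I]
  have harg₁ : -(Complex.exp (-(Complex.I * (π / 4))) / (2 * √η) * t) ^ 2
      = Complex.I * (t ^ 2 / (4 * η)) := by
    rw [mul_pow, div_pow, hsq₁, mul_pow, hη2]
    field_simp
    ring
  have harg₂ : -(Complex.exp (Complex.I * (π / 4)) / 2 * t) ^ 2
      = -(Complex.I * (t ^ 2 / 4)) := by
    rw [mul_pow, div_pow, hsq₂]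
    ring
  simp only [taufun, Pi.add_apply, harg₁, harg₂, mul_add, neg_add, Complex.exp_add]
  rw [mul_div_right_comm _ (t : ℂ) (2 * (√η : ℂ)), mul_div_right_comm _ (t : ℂ) 2,
    Complex.exp_neg (Complex.I * (π / 4))]
  have he := Complex.exp_ne_zero (Complex.I * (π / 4))
  push_cast
  field_simp
  ring

lemma taufun_neg (a : ℕ) (η ξ : ℝ) : taufun a η (-ξ) = taufun a η ξ := by
  simp [taufun, cerf_neg, neg_div]

lemma taufun_zero_re (a : ℕ) (η : ℝ) :
    (taufun a η 0).re = √(2 / π) * (√η + a - 1) := by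
  have h2 : √2 * √2 = 2 := Real.mul_self_sqrt zero_le_two
  have hz : taufun a η 0 = ((√2 / √π : ℝ) : ℂ) *
      (((√η + a - 1 : ℝ) : ℂ) + ((√η - (a - 1) : ℝ) : ℂ) * Complex.I) := by
    simp only [taufun, Complex.ofReal_zero, zero_mul, add_zero, ne_eq, OfNat.ofNat_ne_zero,
      not_false_eq_true, zero_pow, zero_div, exp_pi_div_four_mul_I, exp_neg_pi_div_four_mul_I]
    push_cast
    ring
  rw [hz, Complex.re_ofReal_mul, Real.sqrt_div zero_le_two]
  congr 1
  simp

lemma deriv_taufun_re_nonneg {a : ℕ} (ha : 1 ≤ a) {η ξ : ℝ} (hη : 0 < η) (hξ : 0 ≤ ξ) :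
    0 ≤ (deriv (fun t : ℝ => taufun a η t) ξ).re := by
  have ha' : (0 : ℝ) ≤ a - 1 := sub_nonneg.2 (by exact_mod_cast ha)
  have h₁ := cerf_re_nonneg (σ := -1) (by norm_num) (k := √2 / 2 / (2 * √η)) (by positivity) hξ
  have h₂ := cerf_re_nonneg (σ := 1) (by norm_num) (k := √2 / 2 / 2) (by positivity) hξ
  rw [(hasDerivAt_taufun a hη ξ).deriv, Complex.add_re, Complex.re_ofReal_mul,
    exp_pi_div_four_mul_I, exp_neg_pi_div_four_mul_I]
  refine add_nonneg ?_ (mul_nonneg ha' ?_)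
  · refine h₁.trans_eq (congrArg (fun z => (cerf z).re) ?_)
    push_cast
    ring
  · refine h₂.trans_eq (congrArg (fun z => (cerf z).re) ?_)
    push_cast
    ring

/-- (a) `Re τ_η'(ξ) ≥ 0` for `ξ > 0`; (b) `Re τ_η(ξ) ≥ √(2/π)(√η + α − 1) > 0`. -/
theorem taufun_real_part_bounds (a : ℕ) (ha : 1 ≤ a) (η : ℝ) (hη : 0 < η) :
    (∀ ξ : ℝ, 0 < ξ → 0 ≤ (deriv (fun t : ℝ => taufun a η t) ξ).re) ∧
    0 < Real.sqrt (2 / Real.pi) * (Real.sqrt η + a - 1) ∧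
    ∀ ξ : ℝ, Real.sqrt (2 / Real.pi) * (Real.sqrt η + a - 1) ≤ (taufun a η ξ).re := by
  refine ⟨fun ξ hξ => deriv_taufun_re_nonneg ha hη hξ.le, ?_, ?_⟩
  · have ha' : (1 : ℝ) ≤ a := by exact_mod_cast ha
    have := Real.sqrt_pos.2 hη
    exact mul_pos (Real.sqrt_pos.2 (by positivity)) (by linarith)
  have hre : ∀ ξ : ℝ, HasDerivAt (fun t : ℝ => (taufun a η t).re)
      (deriv (fun t : ℝ => taufun a η t) ξ).re ξ := fun ξ =>
    Complex.reCLM.hasFDerivAt.comp_hasDerivAt ξ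
      (hasDerivAt_taufun a hη ξ).differentiableAt.hasDerivAt
  have hmono : MonotoneOn (fun t : ℝ => (taufun a η t).re) (Set.Ici 0) := by
    refine monotoneOn_of_deriv_nonneg (convex_Ici _)
      (fun t _ => (hre t).continuousAt.continuousWithinAt)
      (fun t _ => (hre t).differentiableAt.differentiableWithinAt) fun t ht => ?_
    rw [interior_Ici] at ht
    rw [(hre t).deriv]
    exact deriv_taufun_re_nonneg ha hη (le_of_lt ht)
  have hnonneg : ∀ ξ : ℝ, 0 ≤ ξ → √(2 / π) * (√η + a - 1) ≤ (taufun a η ξ).re := by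
    intro ξ hξ
    rw [← taufun_zero_re]
    exact hmono Set.self_mem_Ici hξ hξ
  intro ξ
  rcases le_total 0 ξ with h | h
  · exact hnonneg ξ h
  · rw [← taufun_neg]
    exact hnonneg (-ξ) (neg_nonneg.2 h)
end
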